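/- For every blind MDP Γ = (K, A, S, q, g), every initial belief p₁ ∈ Δ(K), and every ε > 0, there exists an eventually periodic strategy σ = (a₁, a₂, …) ∈ A^ℕ that is ε-optimal in Γ(p₁), i.e., γ^{p₁}_∞(σ) ≥ v_∞(p₁) − ε. -/

import Mathlib

open MeasureTheory Filter

namespace PomdpPaper

/-- A belief (probability vector) on `Fin n`. -/
def IsBelief {n : ℕ} (p : Fin n → ℝ) : Prop :=
  (∀ k, 0 ≤ p k) ∧ ∑ k, p k = 1

/-- The measure on a finite type associated with a probability vector. -/
noncomputable def vecMeasure {α : Type*} [Fintype α] [MeasurableSpace α] (p : α → ℝ) :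
    Measure α :=
  ∑ x : α, ENNReal.ofReal (p x) • Measure.dirac x

/-- The Dirac belief at a point. -/
def diracBelief {n : ℕ} (k : Fin n) : Fin n → ℝ := fun k' => if k' = k then 1 else 0

/-- The `i`-th binary digit of a real number `x ∈ [0,1)` (as a real number `0` or `1`). -/
noncomputable def digitR (x : ℝ) (i : ℕ) : ℝ :=
  if ⌊x * 2 ^ (i + 1)⌋ % 2 = 1 then 1 else 0

/-- From one uniform seed `x ∈ [0,1)`, a sequence `unif x 0, unif x 1, …` of
(independent, uniformly distributed on `[0,1]`) real numbers, obtained by splitting the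
binary digits of `x` along the pairing function. -/
noncomputable def unif (x : ℝ) (m : ℕ) : ℝ :=
  ∑' j : ℕ, digitR x (Nat.pair m j) / 2 ^ (j + 1)

open Classical in
/-- Inverse-transform sampling from a probability vector on `Fin n` using a seed `u ∈ [0,1]`. -/
noncomputable def sampleFin {n : ℕ} (hn : 0 < n) (p : Fin n → ℝ) (u : ℝ) : Fin n :=
  let s : Finset (Fin n) :=
    Finset.univ.filter fun y : Fin n => u < ∑ z ∈ Finset.univ.filter fun z : Fin n => z ≤ y, p z
  if hs : s.Nonempty then s.min' hs else ⟨0, hn⟩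

/-- Inverse-transform sampling from a probability vector on a finite nonempty type. -/
noncomputable def sampleOn {β : Type*} [Fintype β] [Nonempty β] (p : β → ℝ) (u : ℝ) : β :=
  (Fintype.equivFin β).symm
    (sampleFin Fintype.card_pos (fun i => p ((Fintype.equivFin β).symm i)) u)

/-- A POMDP with states `Fin nK`, actions `Fin nA`, signals `Fin nS`, transition function `q`
and reward function `g` with values in `[0,1]`. -/
structure POMDP where
  nK : ℕ
  nA : ℕ
  nS : ℕ
  hK : 0 < nK
  hA : 0 < nA
  hS : 0 < nS
  q : Fin nK → Fin nA → Fin nK × Fin nS → ℝ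
  q_nonneg : ∀ k a y, 0 ≤ q k a y
  q_sum : ∀ k a, ∑ y, q k a y = 1
  g : Fin nK → Fin nA → ℝ
  g_nonneg : ∀ k a, 0 ≤ g k a
  g_le_one : ∀ k a, g k a ≤ 1

namespace POMDP

variable (Γ : POMDP)

/-- The state space. -/
abbrev K := Fin Γ.nK
/-- The action space. -/
abbrev A := Fin Γ.nA
/-- The signal space. -/
abbrev S := Fin Γ.nS

instance : Nonempty Γ.K := ⟨⟨0, Γ.hK⟩⟩
instance : Nonempty Γ.A := ⟨⟨0, Γ.hA⟩⟩
instance : Nonempty Γ.S := ⟨⟨0, Γ.hS⟩⟩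

/-- A history: the finite sequence of past actions and signals. -/
abbrev Hist := List (Γ.A × Γ.S)

/-- A (pure) strategy: a map from histories to actions. -/
abbrev Strategy := Γ.Hist → Γ.A

/-- The sample space carrying all the randomness: an initial state together with a
uniform seed in `[0,1)` used to draw all the transitions. -/
abbrev Env := Γ.K × ℝ

/-- The probability measure on the sample space induced by the initial belief `p1`:
the initial state is drawn according to `p1`, the seed uniformly on `[0,1)`. -/
noncomputable def envMeasure (p1 : Γ.K → ℝ) : Measure Γ.Env :=
  (vecMeasure p1).prod (volume.restrict (Set.Ico (0 : ℝ) 1))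

/-- The trajectory: `(Γ.traj σ ω m).1` is the state `k_{m+1}` at stage `m+1` and
`(Γ.traj σ ω m).2` is the history before stage `m+1` (of length `m`), when the
decision-maker uses strategy `σ` and the randomness is `ω`.  At each stage, the pair
(new state, signal) is drawn from `q` via inverse-transform sampling from a fresh
uniform variable. -/
noncomputable def traj (σ : Γ.Strategy) (ω : Γ.Env) : ℕ → Γ.K × Γ.Hist
  | 0 => (ω.1, [])
  | m + 1 =>
    let p := traj σ ω m
    let a := σ p.2
    let y := sampleOn (Γ.q p.1 a) (unif ω.2 m)
    (y.1, p.2 ++ [(a, y.2)])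

/-- The state `k_{m+1}` at stage `m+1` (`m` is 0-indexed). -/
noncomputable def state (σ : Γ.Strategy) (ω : Γ.Env) (m : ℕ) : Γ.K := (Γ.traj σ ω m).1

/-- The history before stage `m+1` (a list of length `m`). -/
noncomputable def hist (σ : Γ.Strategy) (ω : Γ.Env) (m : ℕ) : Γ.Hist := (Γ.traj σ ω m).2

/-- The action `a_{m+1}` played at stage `m+1`. -/
noncomputable def act (σ : Γ.Strategy) (ω : Γ.Env) (m : ℕ) : Γ.A := σ (Γ.hist σ ω m)

/-- The reward `g_{m+1}` obtained at stage `m+1`. -/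
noncomputable def rew (σ : Γ.Strategy) (ω : Γ.Env) (m : ℕ) : ℝ :=
  Γ.g (Γ.state σ ω m) (Γ.act σ ω m)

/-- The average reward over the first `n` stages. -/
noncomputable def avg (σ : Γ.Strategy) (ω : Γ.Env) (n : ℕ) : ℝ :=
  (1 / n : ℝ) * ∑ m ∈ Finset.range n, Γ.rew σ ω m

/-- The probability of an event under initial belief `p1` (the strategy `σ` is recorded for
readability; the underlying measure does not depend on it). -/
noncomputable def prob (p1 : Γ.K → ℝ) (_σ : Γ.Strategy) (E : Set Γ.Env) : ℝ :=
  (Γ.envMeasure p1 E).toReal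

/-- The long-run average payoff `γ^{p1}_∞(σ) = E[liminf (1/n) ∑ g_m]`. -/
noncomputable def pay (p1 : Γ.K → ℝ) (σ : Γ.Strategy) : ℝ :=
  ∫ ω, atTop.liminf (Γ.avg σ ω) ∂(Γ.envMeasure p1)

/-- The payoff starting from a deterministic state `k`, i.e. `γ^k_∞(σ)`. -/
noncomputable def payK (k : Γ.K) (σ : Γ.Strategy) : ℝ := Γ.pay (diracBelief k) σ

/-- The value `v_∞(p1)`. -/
noncomputable def val (p1 : Γ.K → ℝ) : ℝ := ⨆ σ : Γ.Strategy, Γ.pay p1 σ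

/-- A strategy has finite memory if it is implemented by a finite-state transducer. -/
def FiniteMemory (σ : Γ.Strategy) : Prop :=
  ∃ (n : ℕ) (m0 : Fin n) (σa : Fin n → Γ.A) (σu : Fin n → Γ.A × Γ.S → Fin n),
    ∀ h : Γ.Hist, σ h = σa (h.foldl σu m0)

/-- A blind MDP: the signal set is a singleton. -/
def Blind : Prop := Γ.nS = 1

/-- The strategy induced by a sequence of actions `a_1, a_2, …` (`as m` is the action played
at stage `m+1`, regardless of the observed history). -/
def blindStrat (as : ℕ → Γ.A) : Γ.Strategy := fun h => as h.length

end POMDP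

/-- A sequence is eventually periodic if it is periodic with some period `T ≥ 1` from
some stage `N` on. -/
def EventuallyPeriodic {α : Type*} (as : ℕ → α) : Prop :=
  ∃ T ≥ 1, ∃ N ≥ 1, ∀ m ≥ N, as (m + T) = as m



/-- uniform measure on the unit interval -/
noncomputable def lam : Measure ℝ := volume.restrict (Set.Ico (0 : ℝ) 1)

instance lam_prob : IsProbabilityMeasure lam := ⟨by simp [lam]⟩

/-- binary digit as a boolean -/
noncomputable def dB (x : ℝ) (i : ℕ) : Bool := decide (⌊x * 2 ^ (i + 1)⌋ % 2 = 1)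

lemma measurable_dB (i : ℕ) : Measurable (fun x => dB x i) := by
  have h : Measurable (fun x : ℝ => ⌊x * 2 ^ (i + 1)⌋) :=
    Int.measurable_floor.comp (measurable_id.mul_const _)
  exact (measurable_of_countable (fun n : ℤ => decide (n % 2 = 1))).comp h

lemma dB_shift (x : ℝ) (i : ℕ) : dB (Int.fract (2 * x)) i = dB x (i + 1) := by
  have h : Int.fract (2 * x) * 2 ^ (i + 1)
      = x * 2 ^ (i + 1 + 1) - ((⌊2 * x⌋ * 2 ^ (i + 1) : ℤ) : ℝ) := by
    rw [Int.fract]; push_cast; ring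
  unfold dB
  rw [h, Int.floor_sub_intCast]
  congr 2
  have : ((⌊2 * x⌋ * 2 ^ (i + 1) : ℤ)) = 2 * (⌊2 * x⌋ * 2 ^ i) := by ring
  rw [this]
  omega

lemma floor_two_mul_of_lt {x : ℝ} (h0 : 0 ≤ x) (h1 : x < 1 / 2) : ⌊2 * x⌋ = 0 := by
  rw [Int.floor_eq_iff]; constructor <;> push_cast <;> linarith

lemma floor_two_mul_of_ge {x : ℝ} (h0 : 1 / 2 ≤ x) (h1 : x < 1) : ⌊2 * x⌋ = 1 := by
  rw [Int.floor_eq_iff]; constructor <;> push_cast <;> linarith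

lemma measurable_T : Measurable (fun x : ℝ => Int.fract (2 * x)) :=
  measurable_fract.comp (measurable_id.const_mul 2)

lemma lam_false (B : Set ℝ) (hB : MeasurableSet B) :
    lam ({x | dB x 0 = false} ∩ (fun x : ℝ => Int.fract (2 * x)) ⁻¹' B) = lam B / 2 := by
  have hm : MeasurableSet ({x | dB x 0 = false} ∩ (fun x : ℝ => Int.fract (2 * x)) ⁻¹' B) :=
    ((measurable_dB 0) (measurableSet_singleton false)).inter (measurable_T hB)
  rw [lam, Measure.restrict_apply hm, Measure.restrict_apply hB]
  have : ({x | dB x 0 = false} ∩ (fun x : ℝ => Int.fract (2 * x)) ⁻¹' B) ∩ Set.Ico 0 1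
      = (fun x : ℝ => 2 * x) ⁻¹' (B ∩ Set.Ico 0 1) := by
    ext x
    simp only [Set.mem_inter_iff, Set.mem_ofPred_eq, Set.mem_preimage, Set.mem_Ico, dB, zero_add,
      pow_one]
    constructor
    · rintro ⟨⟨h1, h2⟩, h3, h4⟩
      rcases lt_or_ge x (1 / 2) with h | h
      · have hf := floor_two_mul_of_lt h3 h
        rw [Int.fract, hf] at h2
        refine ⟨by simpa using h2, by linarith, by linarith⟩
      · have hf := floor_two_mul_of_ge h h4
        rw [mul_comm, hf] at h1
        simp at h1
    · rintro ⟨h1, h2, h3⟩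
      have hf := floor_two_mul_of_lt (x := x) (by linarith) (by linarith)
      refine ⟨⟨by rw [mul_comm, hf]; simp, by rw [Int.fract, hf]; simpa using h1⟩,
        by linarith, by linarith⟩
  rw [this, Real.volume_preimage_mul_left two_ne_zero, mul_comm, abs_of_nonneg (by norm_num),
    ENNReal.ofReal_inv_of_pos two_pos, ENNReal.div_eq_inv_mul, mul_comm]
  simp

lemma lam_true (B : Set ℝ) (hB : MeasurableSet B) :
    lam ({x | dB x 0 = true} ∩ (fun x : ℝ => Int.fract (2 * x)) ⁻¹' B) = lam B / 2 := by
  have hm : MeasurableSet ({x | dB x 0 = true} ∩ (fun x : ℝ => Int.fract (2 * x)) ⁻¹' B) :=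
    ((measurable_dB 0) (measurableSet_singleton true)).inter (measurable_T hB)
  rw [lam, Measure.restrict_apply hm, Measure.restrict_apply hB]
  have : ({x | dB x 0 = true} ∩ (fun x : ℝ => Int.fract (2 * x)) ⁻¹' B) ∩ Set.Ico 0 1
      = (fun x : ℝ => 2 * x) ⁻¹' ((fun x => x + (-1)) ⁻¹' (B ∩ Set.Ico 0 1)) := by
    ext x
    simp only [Set.mem_inter_iff, Set.mem_ofPred_eq, Set.mem_preimage, Set.mem_Ico, dB, zero_add,
      pow_one]
    constructor
    · rintro ⟨⟨h1, h2⟩, h3, h4⟩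
      rcases lt_or_ge x (1 / 2) with h | h
      · have hf := floor_two_mul_of_lt h3 h
        rw [mul_comm, hf] at h1
        simp at h1
      · have hf := floor_two_mul_of_ge h h4
        rw [Int.fract, hf] at h2
        refine ⟨by simpa [sub_eq_add_neg] using h2, by linarith, by linarith⟩
    · rintro ⟨h1, h2, h3⟩
      have hf := floor_two_mul_of_ge (x := x) (by linarith) (by linarith)
      refine ⟨⟨by rw [mul_comm, hf]; simp, by rw [Int.fract, hf]; simpa [sub_eq_add_neg] using h1⟩,
        by linarith, by linarith⟩
  rw [this, Real.volume_preimage_mul_left two_ne_zero, measure_preimage_add_right, mul_comm,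
    abs_of_nonneg (by norm_num),
    ENNReal.ofReal_inv_of_pos two_pos, ENNReal.div_eq_inv_mul, mul_comm]
  simp

lemma lam_split (E : Set ℝ) :
    lam E = lam ({x | dB x 0 = true} ∩ E) + lam ({x | dB x 0 = false} ∩ E) := by
  have h := measure_inter_add_sdiff (μ := lam) E
    ((measurable_dB 0) (measurableSet_singleton true))
  rw [← h]
  congr 2
  · rw [Set.inter_comm]; rfl
  · ext x; simp [and_comm]

lemma lam_T (B : Set ℝ) (hB : MeasurableSet B) :
    lam ((fun x : ℝ => Int.fract (2 * x)) ⁻¹' B) = lam B := by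
  rw [lam_split, lam_true B hB, lam_false B hB, ENNReal.add_halves]

lemma lam_dB0 (c : Bool) : lam {x | dB x 0 = c} = 1 / 2 := by
  have h1 := lam_true Set.univ MeasurableSet.univ
  have h2 := lam_false Set.univ MeasurableSet.univ
  simp only [Set.preimage_univ, Set.inter_univ, measure_univ] at h1 h2
  cases c <;> assumption

lemma lam_indep (s : Set Bool) (B : Set ℝ) (hB : MeasurableSet B) :
    lam ((fun x => dB x 0) ⁻¹' s ∩ (fun x : ℝ => Int.fract (2 * x)) ⁻¹' B)
      = lam ((fun x => dB x 0) ⁻¹' s) * lam B := by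
  classical
  have key : ∀ c : Bool, ∀ E : Set ℝ, lam ({x | dB x 0 = c} ∩ ((fun x => dB x 0) ⁻¹' s ∩ E))
      = if c ∈ s then lam ({x | dB x 0 = c} ∩ E) else 0 := by
    intro c E
    split_ifs with h
    · congr 1; ext x; simp only [Set.mem_inter_iff, Set.mem_ofPred_eq, Set.mem_preimage]
      constructor
      · tauto
      · rintro ⟨rfl, h2⟩; tauto
    · convert! measure_empty (μ := lam)
      ext x; simp only [Set.mem_inter_iff, Set.mem_ofPred_eq, Set.mem_preimage,
        Set.mem_empty_iff_false, iff_false]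
      rintro ⟨rfl, h2⟩; tauto
  have hu : (fun x => dB x 0) ⁻¹' s = (fun x => dB x 0) ⁻¹' s ∩ Set.univ := by simp
  rw [lam_split, key, key, lam_true B hB, lam_false B hB]
  conv_rhs => rw [hu, lam_split, key, key]
  simp only [Set.inter_univ, lam_dB0]
  split_ifs <;> simp [add_mul, ENNReal.div_eq_inv_mul]

lemma lam_dB_map (i : ℕ) (s : Set Bool) :
    lam ((fun x => dB x i) ⁻¹' s) = lam ((fun x => dB x 0) ⁻¹' s) := by
  induction i with
  | zero => rfl
  | succ i ih =>
    rw [← ih, ← lam_T _ (measurable_dB i (MeasurableSet.of_discrete (s := s)))]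
    congr 1; ext x; simp [dB_shift]

lemma lam_prodN (N : ℕ) (s : ℕ → Set Bool) :
    lam (⋂ i ∈ Finset.range N, (fun x => dB x i) ⁻¹' s i)
      = ∏ i ∈ Finset.range N, lam ((fun x => dB x i) ⁻¹' s i) := by
  induction N generalizing s with
  | zero => simp
  | succ N ih =>
    rw [Finset.prod_range_succ']
    have h := ih (fun i => s (i + 1))
    have h2 : ∀ i, lam ((fun x => dB x i) ⁻¹' s (i + 1))
        = lam ((fun x => dB x (i+1)) ⁻¹' s (i + 1)) := fun i => by
      rw [lam_dB_map, ← lam_dB_map (i + 1)]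
    simp only [h2] at h
    have hm : MeasurableSet (⋂ i ∈ Finset.range N, (fun x => dB x i) ⁻¹' s (i + 1)) :=
      Finset.measurableSet_biInter _ fun i _ => measurable_dB i MeasurableSet.of_discrete
    rw [mul_comm, ← h, ← lam_indep _ _ hm]
    congr 1
    ext x
    simp only [Set.mem_iInter, Finset.mem_range, Set.mem_preimage, Set.mem_inter_iff, dB_shift]
    constructor
    · intro h; exact ⟨h 0 (by omega), fun i hi => h (i+1) (by omega)⟩
    · rintro ⟨h0, h1⟩ i hi
      cases i with
      | zero => exact h0
      | succ i => exact h1 i (by omega)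

lemma iIndepFun_dB : ProbabilityTheory.iIndepFun (fun i x => dB x i) lam := by
  classical
  rw [ProbabilityTheory.iIndepFun_iff_measure_inter_preimage_eq_mul]
  intro S sets _
  obtain ⟨N, hN⟩ : ∃ N, S ⊆ Finset.range N := ⟨S.sup id + 1, fun i hi => by
    have := Finset.le_sup (f := id) hi
    simp at this ⊢; omega⟩
  have h := lam_prodN N (fun i => if i ∈ S then sets i else Set.univ)
  have e1 : (⋂ i ∈ Finset.range N, (fun x => dB x i) ⁻¹' (if i ∈ S then sets i else Set.univ))
      = ⋂ i ∈ S, (fun x => dB x i) ⁻¹' sets i := by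
    ext x
    simp only [Set.mem_iInter, Set.mem_preimage]
    constructor
    · intro h i hi
      have := h i (hN hi)
      simpa [hi] using this
    · intro h i _
      by_cases hi : i ∈ S
      · simpa [hi] using h i hi
      · simp [hi]
  rw [← e1, h]
  rw [← Finset.prod_subset hN]
  · exact Finset.prod_congr rfl fun i hi => by simp [hi]
  · intro i _ hi; rw [if_neg hi, Set.preimage_univ, measure_univ]

/-- value of a binary expansion -/
noncomputable def hb (b : ℕ → Bool) : ℝ := ∑' j : ℕ, (if b j then (1 : ℝ) else 0) / 2 ^ (j + 1)

lemma summable_hb (b : ℕ → Bool) :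
    Summable (fun j : ℕ => (if b j then (1 : ℝ) else 0) / 2 ^ (j + 1)) := by
  refine Summable.of_nonneg_of_le (fun j => by positivity) (fun j => ?_)
    (summable_geometric_two)
  rw [one_div, inv_pow, ← one_div]
  refine div_le_div₀ (by norm_num) (by split_ifs <;> norm_num) (by positivity) ?_
  exact pow_le_pow_right₀ (by norm_num) (by omega)

lemma measurable_hb : Measurable hb := by
  refine measurable_of_tendsto_metrizable
    (f := fun n b => ∑ j ∈ Finset.range n, (if b j then (1 : ℝ) else 0) / 2 ^ (j + 1)) ?_ ?_
  · intro n
    refine Finset.measurable_sum _ fun j _ => Measurable.div_const ?_ _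
    exact (measurable_of_countable (fun c : Bool => if c then (1 : ℝ) else 0)).comp
      (measurable_pi_apply j)
  · rw [tendsto_pi_nhds]
    exact fun b => (summable_hb b).hasSum.tendsto_sum_nat

lemma unif_eq (x : ℝ) (m : ℕ) : unif x m = hb (fun j => dB x (Nat.pair m j)) := by
  unfold unif hb digitR dB
  simp

lemma measurable_unif (m : ℕ) : Measurable (fun x => unif x m) := by
  simp only [unif_eq]
  exact measurable_hb.comp (measurable_pi_iff.2 fun j => measurable_dB _)

lemma hb_dB {x : ℝ} (hx : x ∈ Set.Ico (0 : ℝ) 1) : hb (fun j => dB x j) = x := by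
  refine HasSum.tsum_eq ?_
  rw [(summable_hb _).hasSum_iff_tendsto_nat]
  have hs : ∀ n : ℕ, ∑ j ∈ Finset.range n, (if dB x j then (1 : ℝ) else 0) / 2 ^ (j + 1)
      = (⌊x * 2 ^ n⌋ : ℝ) / 2 ^ n := by
    intro n
    induction n with
    | zero =>
      have : ⌊x⌋ = 0 := by rw [Int.floor_eq_iff]; simpa using hx
      simp [this]
    | succ n ih =>
      rw [Finset.sum_range_succ, ih]
      have h1 : (⌊x * 2 ^ (n + 1)⌋ : ℝ)
          = 2 * ⌊x * 2 ^ n⌋ + (if dB x n then (1 : ℝ) else 0) := by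
        have h2 : ⌊x * 2 ^ (n + 1)⌋ / 2 = ⌊x * 2 ^ n⌋ := by
          have := Int.floor_div_natCast (x * 2 ^ (n + 1)) 2
          rw [show ((2 : ℕ) : ℤ) = 2 from rfl] at this
          rw [← this]
          rw [pow_succ]; congr 1; push_cast; field_simp
        have h3 := Int.emod_two_eq_zero_or_one ⌊x * 2 ^ (n + 1)⌋
        have h4 := Int.mul_ediv_add_emod ⌊x * 2 ^ (n + 1)⌋ 2
        rw [h2] at h4
        have h5 : ((2 * ⌊x * 2 ^ n⌋ + ⌊x * 2 ^ (n + 1)⌋ % 2 : ℤ) : ℝ) = ⌊x * 2 ^ (n + 1)⌋ := by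
          exact_mod_cast h4
        rw [← h5]
        rcases h3 with h3 | h3 <;> simp [dB, h3]
      rw [h1, pow_succ]; field_simp
  simp only [hs]
  have hl : ∀ n : ℕ, x - (1 / 2) ^ n ≤ (⌊x * 2 ^ n⌋ : ℝ) / 2 ^ n := fun n => by
    rw [le_div_iff₀ (by positivity), sub_mul, ← mul_pow]
    have := Int.sub_one_lt_floor (x * 2 ^ n)
    norm_num; linarith
  have hu : ∀ n : ℕ, (⌊x * 2 ^ n⌋ : ℝ) / 2 ^ n ≤ x := fun n => by
    rw [div_le_iff₀ (by positivity)]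
    exact Int.floor_le _
  have hlim : Tendsto (fun n : ℕ => x - (1 / 2 : ℝ) ^ n) atTop (nhds x) := by
    have := (tendsto_pow_atTop_nhds_zero_of_lt_one (r := (1/2 : ℝ)) (by norm_num)
      (by norm_num)).const_sub x
    simpa using this
  exact tendsto_of_tendsto_of_tendsto_of_le_of_le hlim tendsto_const_nhds hl hu

/-- the fair coin -/
noncomputable def coin : Measure Bool := lam.map (fun x => dB x 0)

instance : IsProbabilityMeasure coin :=
  Measure.isProbabilityMeasure_map (measurable_dB 0).aemeasurable

lemma map_dB (i : ℕ) : lam.map (fun x => dB x i) = coin := by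
  ext s hs
  rw [coin, Measure.map_apply (measurable_dB i) hs, Measure.map_apply (measurable_dB 0) hs,
    lam_dB_map]

lemma map_digits : lam.map (fun x i => dB x i) = Measure.infinitePi (fun _ : ℕ => coin) := by
  rw [iIndepFun_dB.map_fun_eq_infinitePi_map measurable_dB]
  simp only [map_dB]

lemma map_hb : (Measure.infinitePi (fun _ : ℕ => coin)).map hb = lam := by
  rw [← map_digits, Measure.map_map measurable_hb (measurable_pi_iff.2 measurable_dB)]
  have : (hb ∘ fun x i => dB x i) =ᵐ[lam] id := by
    unfold lam
    filter_upwards [ae_restrict_mem measurableSet_Ico] with x hx using hb_dB hx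
  rw [Measure.map_congr this, Measure.map_id]

lemma map_rows : lam.map (fun x (m j : ℕ) => dB x (Nat.pair m j))
    = Measure.infinitePi (fun _ : ℕ => Measure.infinitePi (fun _ : ℕ => coin)) := by
  rw [← Measure.infinitePi_map_curry (fun _ _ => coin)]
  have hinj : Function.Injective (fun p : ℕ × ℕ => Nat.pair p.1 p.2) := fun a b h => by
    simpa [Prod.ext_iff] using h
  rw [← Measure.map_infinitePi_infinitePi_of_inj (P := fun _ : ℕ => coin) hinj, ← map_digits,
    Measure.map_map, Measure.map_map]
  · rfl
  all_goals first
    | exact measurable_pi_iff.2 measurable_dB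
    | exact MeasurableEquiv.measurable _
    | fun_prop
    | exact measurable_pi_iff.2 fun p => measurable_dB _

lemma map_unifs : lam.map (fun x m => unif x m) = Measure.infinitePi (fun _ : ℕ => lam) := by
  have h := Measure.infinitePi_map_pi (fun _ : ℕ => Measure.infinitePi (fun _ : ℕ => coin))
    (f := fun _ => hb) (fun _ => measurable_hb)
  simp only [map_hb] at h
  rw [← h, ← map_rows, Measure.map_map]
  · congr 1; ext x m; simp [unif_eq]
  · exact measurable_pi_iff.2 fun m => measurable_hb.comp (measurable_pi_apply m)
  · exact measurable_pi_iff.2 fun m => measurable_pi_iff.2 fun j => measurable_dB _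

lemma map_unif (m : ℕ) : lam.map (fun x => unif x m) = lam := by
  have h := Measure.infinitePi_map_eval (fun _ : ℕ => lam) m
  rw [← map_unifs, Measure.map_map (measurable_pi_apply m) (measurable_pi_iff.2 measurable_unif)]
    at h
  exact h

lemma iIndepFun_unif : ProbabilityTheory.iIndepFun (fun m x => unif x m) lam := by
  rw [ProbabilityTheory.iIndepFun_iff_map_fun_eq_infinitePi_map measurable_unif, map_unifs]
  simp only [map_unif]



lemma sampleFin_le_iff {n : ℕ} (hn : 0 < n) (p : Fin n → ℝ) (hp : ∀ i, 0 ≤ p i)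
    (hs : ∑ i, p i = 1) {u : ℝ} (h1 : u < 1) (y : Fin n) :
    sampleFin hn p u ≤ y ↔ u < ∑ z ∈ Finset.univ.filter (fun z : Fin n => z ≤ y), p z := by
  classical
  have hne : (Finset.univ.filter fun y : Fin n =>
      u < ∑ z ∈ Finset.univ.filter fun z : Fin n => z ≤ y, p z).Nonempty := by
    refine ⟨⟨n - 1, by omega⟩, ?_⟩
    simp only [Finset.mem_filter, Finset.mem_univ, true_and]
    rw [Finset.filter_true_of_mem, hs]
    · exact h1
    · intro z _; rw [Fin.le_def]; have := z.2; simp; omega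
  have hdef : sampleFin hn p u = (Finset.univ.filter fun y : Fin n =>
      u < ∑ z ∈ Finset.univ.filter fun z : Fin n => z ≤ y, p z).min' hne := by
    unfold sampleFin
    simp only
    rw [dif_pos]
  rw [hdef]
  constructor
  · intro h
    have hm := Finset.min'_mem _ hne
    rw [Finset.mem_filter] at hm
    refine lt_of_lt_of_le hm.2 (Finset.sum_le_sum_of_subset_of_nonneg ?_ fun i _ _ => hp i)
    intro z hz
    simp only [Finset.mem_filter, Finset.mem_univ, true_and] at hz ⊢
    exact hz.trans h
  · intro h
    apply Finset.min'_le
    simpa using h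

lemma measurable_sampleFin {n : ℕ} (hn : 0 < n) (p : Fin n → ℝ) : Measurable (sampleFin hn p) := by
  classical
  let s : ℝ → (Fin n → Bool) := fun u y =>
    decide (u < ∑ z ∈ Finset.univ.filter (fun z : Fin n => z ≤ y), p z)
  have hsm : Measurable s := by
    refine measurable_pi_iff.2 fun y => ?_
    refine measurable_to_bool ?_
    have : (fun u => s u y) ⁻¹' {true}
        = Set.Iio (∑ z ∈ Finset.univ.filter (fun z : Fin n => z ≤ y), p z) := by
      ext u; simp [s]
    rw [this]; exact measurableSet_Iio
  have : sampleFin hn p = (fun b : Fin n → Bool =>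
      if hs : (Finset.univ.filter fun y : Fin n => b y = true).Nonempty then
        (Finset.univ.filter fun y : Fin n => b y = true).min' hs else ⟨0, hn⟩) ∘ s := by
    ext u
    simp only [sampleFin, s, Function.comp, decide_eq_true_eq]
  rw [this]
  exact (measurable_of_countable _).comp hsm

lemma lam_sampleFin {n : ℕ} (hn : 0 < n) (p : Fin n → ℝ) (hp : ∀ i, 0 ≤ p i)
    (hs : ∑ i, p i = 1) (y : Fin n) : lam {u | sampleFin hn p u = y} = ENNReal.ofReal (p y) := by
  have hm : MeasurableSet {u | sampleFin hn p u = y} :=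
    measurable_sampleFin hn p (measurableSet_singleton y)
  set a := ∑ z ∈ Finset.univ.filter (fun z : Fin n => z < y), p z with ha
  have hb : ∑ z ∈ Finset.univ.filter (fun z : Fin n => z ≤ y), p z = a + p y := by
    have : Finset.univ.filter (fun z : Fin n => z ≤ y)
        = insert y (Finset.univ.filter (fun z : Fin n => z < y)) := by
      ext z; simp [le_iff_lt_or_eq, or_comm]
    rw [this, Finset.sum_insert (by simp), add_comm]
  have ha0 : 0 ≤ a := Finset.sum_nonneg fun i _ => hp i
  have hb1 : a + p y ≤ 1 := by
    rw [← hb, ← hs]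
    exact Finset.sum_le_sum_of_subset_of_nonneg (Finset.filter_subset _ _) fun i _ _ => hp i
  rw [lam, Measure.restrict_apply hm]
  have : {u | sampleFin hn p u = y} ∩ Set.Ico 0 1 = Set.Ico a (a + p y) := by
    ext u
    simp only [Set.mem_inter_iff, Set.mem_ofPred_eq, Set.mem_Ico]
    have hlt : ∀ u : ℝ, 0 ≤ u → u < 1 → (sampleFin hn p u < y ↔ u < a) := by
      intro u h0 h1
      by_cases hy : (y : ℕ) = 0
      · have : a = 0 := by
          rw [ha]; apply Finset.sum_eq_zero; intro z hz
          simp [Fin.lt_def, hy] at hz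
        rw [this]
        constructor
        · intro h; rw [Fin.lt_def] at h; omega
        · intro h; linarith
      · have hy' : (y : ℕ) - 1 < n := by have := y.2; omega
        have h := sampleFin_le_iff hn p hp hs h1 ⟨(y : ℕ) - 1, hy'⟩
        have e : ∀ z : Fin n, z ≤ ⟨(y : ℕ) - 1, hy'⟩ ↔ z < y := by
          intro z; rw [Fin.le_def, Fin.lt_def]; simp; omega
        simp only [e] at h
        exact h
    constructor
    · rintro ⟨h, h0, h1⟩
      refine ⟨?_, ?_⟩
      · by_contra hc
        have := (hlt u h0 h1).2 (not_le.1 hc)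
        exact absurd h (ne_of_lt this)
      · rw [← hb, ← sampleFin_le_iff hn p hp hs h1]; exact h.le
    · rintro ⟨h, h'⟩
      have h0 : 0 ≤ u := ha0.trans h
      have h1 : u < 1 := h'.trans_le hb1
      refine ⟨?_, h0, h1⟩
      apply le_antisymm
      · rw [sampleFin_le_iff hn p hp hs h1, hb]; exact h'
      · by_contra hc
        have := (hlt u h0 h1).1 (not_le.1 hc)
        linarith
  rw [this, Real.volume_Ico]; simp

lemma measurable_sampleOn {β : Type*} [Fintype β] [Nonempty β] [MeasurableSpace β] (p : β → ℝ) :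
    Measurable (sampleOn p) :=
  (measurable_of_countable (Fintype.equivFin β).symm).comp (measurable_sampleFin _ _)

lemma lam_sampleOn {β : Type*} [Fintype β] [Nonempty β]
    (p : β → ℝ) (hp : ∀ i, 0 ≤ p i) (hs : ∑ i, p i = 1) (y : β) :
    lam {u | sampleOn p u = y} = ENNReal.ofReal (p y) := by
  have := lam_sampleFin (Fintype.card_pos (α := β)) (fun i => p ((Fintype.equivFin β).symm i))
    (fun i => hp _) (by rw [← hs]; exact Equiv.sum_comp (Fintype.equivFin β).symm p)
    (Fintype.equivFin β y)
  simp only [Equiv.symm_apply_apply] at this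
  rw [← this]
  congr 1; ext u
  simp [sampleOn, Equiv.symm_apply_eq]

lemma integrable_of_bdd {f : ℝ → ℝ} (hf : Measurable f) {C : ℝ} (h : ∀ x, |f x| ≤ C) :
    Integrable f lam :=
  Integrable.of_bound hf.aestronglyMeasurable C (ae_of_all _ h)

lemma exists_bdd {β : Type*} [Finite β] (f : β → ℝ) : ∃ C, 0 ≤ C ∧ ∀ y, |f y| ≤ C := by
  cases nonempty_fintype β
  exact ⟨∑ y, |f y|, Finset.sum_nonneg fun _ _ => abs_nonneg _,
    fun y => Finset.single_le_sum (f := fun y => |f y|) (fun i _ => abs_nonneg _)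
      (Finset.mem_univ y)⟩

lemma integral_sampleOn {β : Type*} [Fintype β] [Nonempty β] [MeasurableSpace β]
    [MeasurableSingletonClass β]
    (p : β → ℝ) (hp : ∀ i, 0 ≤ p i) (hs : ∑ i, p i = 1) (f : β → ℝ) :
    ∫ u, f (sampleOn p u) ∂lam = ∑ y, p y * f y := by
  classical
  have h : ∀ u, f (sampleOn p u) = ∑ y, Set.indicator {u | sampleOn p u = y} (fun _ => f y) u := by
    intro u
    simp [Set.indicator_apply]
  have hm : ∀ y, MeasurableSet {u | sampleOn p u = y} := fun y =>
    measurable_sampleOn p (measurableSet_singleton y)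
  simp only [h]
  rw [integral_finsetSum]
  · refine Finset.sum_congr rfl fun y _ => ?_
    rw [integral_indicator_const _ (hm y), Measure.real, lam_sampleOn p hp hs,
      ENNReal.toReal_ofReal (hp y), smul_eq_mul]
  · intro y _
    exact (integrable_const (f y)).indicator (hm y)

namespace POMDP
variable (Γ : POMDP)

/-- transition matrix on states -/
def tr (a : Γ.A) (k k' : Γ.K) : ℝ := ∑ s, Γ.q k a (k', s)

lemma tr_nonneg (a : Γ.A) (k k' : Γ.K) : 0 ≤ Γ.tr a k k' :=
  Finset.sum_nonneg fun _ _ => Γ.q_nonneg _ _ _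

lemma tr_sum (a : Γ.A) (k : Γ.K) : ∑ k', Γ.tr a k k' = 1 := by
  rw [← Γ.q_sum k a, Fintype.sum_prod_type]; rfl

/-- one-step expectation -/
def ex (a : Γ.A) (f : Γ.K → ℝ) (k : Γ.K) : ℝ := ∑ k', Γ.tr a k k' * f k'

lemma ex_mono (a : Γ.A) {f g : Γ.K → ℝ} (h : ∀ k, f k ≤ g k) (k : Γ.K) :
    Γ.ex a f k ≤ Γ.ex a g k :=
  Finset.sum_le_sum fun k' _ => mul_le_mul_of_nonneg_left (h k') (Γ.tr_nonneg _ _ _)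

lemma ex_const (a : Γ.A) (c : ℝ) (k : Γ.K) : Γ.ex a (fun _ => c) k = c := by
  rw [ex, ← Finset.sum_mul, tr_sum, one_mul]

lemma ex_add_const (a : Γ.A) (f : Γ.K → ℝ) (c : ℝ) (k : Γ.K) :
    Γ.ex a (fun k => f k + c) k = Γ.ex a f k + c := by
  simp only [ex, mul_add, Finset.sum_add_distrib, ← Finset.sum_mul, tr_sum, one_mul]

lemma ex_abs_le (a : Γ.A) {f : Γ.K → ℝ} {C : ℝ} (h : ∀ k, |f k| ≤ C) (k : Γ.K) :
    |Γ.ex a f k| ≤ C := by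
  rw [abs_le]
  constructor
  · rw [← Γ.ex_const a (-C) k]; exact Γ.ex_mono a (fun k => (abs_le.1 (h k)).1) k
  · rw [← Γ.ex_const a C k]; exact Γ.ex_mono a (fun k => (abs_le.1 (h k)).2) k

/-- the state process -/
noncomputable def st (as : ℕ → Γ.A) (k0 : Γ.K) (x : ℝ) : ℕ → Γ.K
  | 0 => k0
  | m + 1 => (sampleOn (Γ.q (st as k0 x m) (as m)) (unif x m)).1

/-- past sigma-algebra -/
@[reducible] noncomputable def past (m : ℕ) : MeasurableSpace ℝ :=
  ⨆ i ∈ {i : ℕ | i < m}, MeasurableSpace.comap (fun x => unif x i) inferInstance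

lemma past_le (m : ℕ) : past m ≤ (inferInstance : MeasurableSpace ℝ) :=
  iSup₂_le fun i _ => (measurable_unif i).comap_le

lemma past_mono {m n : ℕ} (h : m ≤ n) : past m ≤ past n :=
  iSup₂_le fun i hi => le_iSup₂_of_le (f := fun i (_ : i ∈ {i : ℕ | i < n}) =>
    MeasurableSpace.comap (fun x => unif x i) inferInstance) i (lt_of_lt_of_le hi h) le_rfl

lemma unif_past (m : ℕ) : Measurable[past (m + 1)] (fun x => unif x m) := by
  have : MeasurableSpace.comap (fun x => unif x m) inferInstance ≤ past (m + 1) :=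
    le_iSup₂_of_le (f := fun i (_ : i ∈ {i : ℕ | i < m + 1}) =>
    MeasurableSpace.comap (fun x => unif x i) inferInstance) m (Nat.lt_succ_self m) le_rfl
  exact measurable_iff_comap_le.2 this

lemma st_past (as : ℕ → Γ.A) (k0 : Γ.K) (m : ℕ) :
    Measurable[past m] (fun x => Γ.st as k0 x m) := by
  induction m with
  | zero => exact @measurable_const _ _ _ (past 0) _
  | succ m ih =>
    have h1 : Measurable[past (m + 1)] (fun x => Γ.st as k0 x m) :=
      ih.mono (past_mono (Nat.le_succ m)) le_rfl
    refine @measurable_to_countable' _ _ _ _ (past (m + 1)) _ fun k' => ?_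
    have : (fun x => Γ.st as k0 x (m + 1)) ⁻¹' {k'} = ⋃ k : Γ.K,
        ((fun x => Γ.st as k0 x m) ⁻¹' {k}) ∩
        ((fun x => unif x m) ⁻¹' {u | (sampleOn (Γ.q k (as m)) u).1 = k'}) := by
      ext x; simp [st]
    rw [this]
    refine @MeasurableSet.iUnion _ _ (past (m + 1)) _ _ fun k => ?_
    refine @MeasurableSet.inter _ (past (m + 1)) _ _ (h1 (measurableSet_singleton k)) ?_
    refine unif_past m ?_
    exact (measurable_fst.comp (measurable_sampleOn (Γ.q k (as m)))) (measurableSet_singleton k')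

lemma measurable_st (as : ℕ → Γ.A) (k0 : Γ.K) (m : ℕ) :
    Measurable (fun x => Γ.st as k0 x m) := (Γ.st_past as k0 m).mono (past_le m) le_rfl

lemma indep_past (m : ℕ) : ProbabilityTheory.Indep (past m)
    (MeasurableSpace.comap (fun x => unif x m) inferInstance) lam := by
  have h : ProbabilityTheory.iIndep
    (fun i => MeasurableSpace.comap (fun x => unif x i) inferInstance) lam := iIndepFun_unif
  have := ProbabilityTheory.indep_iSup_of_disjoint (fun k => (measurable_unif k).comap_le) h
    (S := {i | i < m}) (T := {m}) (by simp)
  rwa [iSup_singleton] at this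

lemma integral_step (m : ℕ) (a : Γ.A) (k : Γ.K) (f : Γ.K → ℝ) :
    ∫ x, f (sampleOn (Γ.q k a) (unif x m)).1 ∂lam = Γ.ex a f k := by
  have h1 := integral_sampleOn (Γ.q k a) (Γ.q_nonneg k a) (Γ.q_sum k a) (fun y => f y.1)
  have h2 : Measurable (fun u => f (sampleOn (Γ.q k a) u).1) :=
    (measurable_of_countable (fun y : Γ.K × Γ.S => f y.1)).comp (measurable_sampleOn _)
  rw [← map_unif m, integral_map (measurable_unif m).aemeasurable
    h2.aestronglyMeasurable] at h1
  rw [h1, Fintype.sum_prod_type]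
  simp only [ex, tr, Finset.sum_mul]

lemma cond_step (as : ℕ → Γ.A) (k0 : Γ.K) (m : ℕ) (ψ : ℝ → ℝ) (hψ : Measurable[past m] ψ)
    (hb : ∃ C, ∀ x, |ψ x| ≤ C) (f : Γ.K → ℝ) :
    ∫ x, ψ x * f (Γ.st as k0 x (m + 1)) ∂lam
      = ∫ x, ψ x * Γ.ex (as m) f (Γ.st as k0 x m) ∂lam := by
  classical
  obtain ⟨C, hC⟩ := hb
  obtain ⟨F, hF0, hF⟩ := exists_bdd f
  have hS : ∀ k, MeasurableSet[past m] {x | Γ.st as k0 x m = k} := fun k =>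
    Γ.st_past as k0 m (measurableSet_singleton k)
  let φ : Γ.K → ℝ → ℝ := fun k => Set.indicator {x | Γ.st as k0 x m = k} ψ
  have hφ : ∀ k, Measurable[past m] (φ k) := fun k => hψ.indicator (hS k)
  have hφ' : ∀ k, Measurable (φ k) := fun k => (hφ k).mono (past_le m) le_rfl
  have hφb : ∀ k x, |φ k x| ≤ C := fun k x => by
    simp only [φ, Set.indicator_apply]
    split_ifs
    · exact hC x
    · simpa using (abs_nonneg _).trans (hC x)
  let Y : Γ.K → ℝ → ℝ := fun k x => f (sampleOn (Γ.q k (as m)) (unif x m)).1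
  have hYu : ∀ k, Measurable (fun u => f (sampleOn (Γ.q k (as m)) u).1) := fun k =>
    (measurable_of_countable (fun y : Γ.K × Γ.S => f y.1)).comp (measurable_sampleOn _)
  have hY : ∀ k, Measurable (Y k) := fun k => (hYu k).comp (measurable_unif m)
  have e1 : ∀ x, ψ x * f (Γ.st as k0 x (m + 1)) = ∑ k, φ k x * Y k x := by
    intro x
    rw [Finset.sum_eq_single (Γ.st as k0 x m)]
    · simp [φ, Y, st]
    · intro k _ hk
      simp [φ, hk.symm]
    · simp
  have e2 : ∀ x, ψ x * Γ.ex (as m) f (Γ.st as k0 x m) = ∑ k, φ k x * Γ.ex (as m) f k := by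
    intro x
    rw [Finset.sum_eq_single (Γ.st as k0 x m)]
    · simp [φ]
    · intro k _ hk
      simp [φ, hk.symm]
    · simp
  simp only [e1, e2]
  rw [integral_finsetSum, integral_finsetSum]
  · refine Finset.sum_congr rfl fun k _ => ?_
    have hind : ProbabilityTheory.IndepFun (φ k) (Y k) lam := by
      rw [ProbabilityTheory.IndepFun_iff_Indep]
      refine ProbabilityTheory.indep_of_indep_of_le_left
        (ProbabilityTheory.indep_of_indep_of_le_right (indep_past m) ?_) ?_
      · have : Y k = (fun u => f (sampleOn (Γ.q k (as m)) u).1) ∘ (fun x => unif x m) := rfl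
        rw [this, ← MeasurableSpace.comap_comp]
        exact MeasurableSpace.comap_mono (hYu k).comap_le
      · exact (hφ k).comap_le
    rw [hind.integral_fun_mul_eq_mul_integral (hφ' k).aestronglyMeasurable
      (hY k).aestronglyMeasurable, integral_mul_const, integral_step]
  · intro k _
    exact (integrable_of_bdd (hφ' k) (hφb k)).mul_const _
  · intro k _
    refine integrable_of_bdd ((hφ' k).mul (hY k)) (C := C * F) fun x => ?_
    rw [abs_mul]
    exact mul_le_mul (hφb k x) (hF _) (abs_nonneg _) ((abs_nonneg _).trans (hφb k x))

end POMDP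


lemma fill_gaps (M : ℕ → ℝ) (C : ℝ) (hM : ∀ n, |M (n + 1) - M n| ≤ C)
    (h : Tendsto (fun i : ℕ => M (i ^ 2) / (i : ℝ) ^ 2) atTop (nhds 0)) :
    Tendsto (fun n : ℕ => M n / n) atTop (nhds 0) := by
  have hC : 0 ≤ C := (abs_nonneg _).trans (hM 0)
  have hlip : ∀ n d, |M (n + d) - M n| ≤ C * d := by
    intro n d
    induction d with
    | zero => simp
    | succ d ih =>
      have := hM (n + d)
      have e : M (n + (d + 1)) - M n = (M (n + d + 1) - M (n + d)) + (M (n + d) - M n) := by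
        rw [← add_assoc]; ring
      rw [e]; push_cast
      refine (abs_add_le _ _).trans ?_
      linarith
  have hsq : Tendsto Nat.sqrt atTop atTop := by
    refine tendsto_atTop.2 fun b => ?_
    filter_upwards [eventually_ge_atTop (b * b)] with n hn using Nat.le_sqrt.2 hn
  have h1 : Tendsto (fun i : ℕ => |M (i ^ 2) / (i : ℝ) ^ 2| + 2 * C * (1 / (i : ℝ))) atTop
      (nhds 0) := by
    have := (h.abs).add (tendsto_one_div_atTop_nhds_zero_nat.const_mul (2 * C))
    simpa using this
  refine squeeze_zero_norm' ?_ (h1.comp hsq)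
  filter_upwards [eventually_ge_atTop 1] with n hn
  set i := Nat.sqrt n with hi
  have hi1 : 1 ≤ i := Nat.le_sqrt.2 (by simpa using hn)
  have hle : i ^ 2 ≤ n := by rw [pow_two]; exact Nat.sqrt_le n
  have hlt : n ≤ i ^ 2 + 2 * i := by
    have := Nat.sqrt_le_add n
    rw [← hi] at this
    rw [pow_two]; omega
  obtain ⟨d, hd⟩ := Nat.exists_eq_add_of_le hle
  have hd2 : d ≤ 2 * i := by omega
  have hl := hlip (i ^ 2) d
  rw [← hd] at hl
  have hip : (0 : ℝ) < i := by exact_mod_cast hi1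
  have hnp : (0 : ℝ) < n := by exact_mod_cast hn
  have hle' : (i : ℝ) ^ 2 ≤ n := by exact_mod_cast hle
  have hd2' : (d : ℝ) ≤ 2 * i := by exact_mod_cast hd2
  simp only [Function.comp]
  rw [Real.norm_eq_abs, abs_div, abs_div, abs_of_pos hnp, abs_of_pos (pow_pos hip 2)]
  have hMn : |M n| ≤ |M (i ^ 2)| + C * (2 * i) := by
    have h3 : |M n| ≤ |M n - M (i^2)| + |M (i ^ 2)| := by
      have := abs_add_le (M n - M (i^2)) (M (i^2)); simpa using this
    have : C * d ≤ C * (2 * i) := mul_le_mul_of_nonneg_left hd2' hC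
    linarith
  calc |M n| / n ≤ (|M (i ^ 2)| + C * (2 * i)) / (i : ℝ) ^ 2 := by
        apply div_le_div₀ (by positivity) hMn (by positivity) hle'
    _ = |M (i ^ 2)| / (i : ℝ) ^ 2 + 2 * C * (1 / (i : ℝ)) := by
        field_simp

namespace POMDP
variable (Γ : POMDP)

/-- martingale sum -/
noncomputable def mg (as : ℕ → Γ.A) (f : ℕ → Γ.K → ℝ) (k0 : Γ.K) (N : ℕ) (x : ℝ) : ℝ :=
  ∑ m ∈ Finset.range N,
    (f m (Γ.st as k0 x (m + 1)) - Γ.ex (as m) (f m) (Γ.st as k0 x m))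

lemma comp_past (as : ℕ → Γ.A) (k0 : Γ.K) (f : Γ.K → ℝ) (m : ℕ) :
    Measurable[past m] (fun x => f (Γ.st as k0 x m)) :=
  (measurable_of_countable f).comp (Γ.st_past as k0 m)

lemma mg_past (as : ℕ → Γ.A) (f : ℕ → Γ.K → ℝ) (k0 : Γ.K) (N : ℕ) :
    Measurable[past N] (Γ.mg as f k0 N) := by
  refine @Finset.measurable_fun_sum _ _ _ _ _ _ (past N) _ _ fun m hm => ?_
  have hm' : m + 1 ≤ N := Finset.mem_range.1 hm
  have h1 : Measurable[past N] (fun x => f m (Γ.st as k0 x (m + 1))) :=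
    (Γ.comp_past as k0 (f m) (m + 1)).mono (past_mono hm') le_rfl
  have h2 : Measurable[past N] (fun x => Γ.ex (as m) (f m) (Γ.st as k0 x m)) :=
    (Γ.comp_past as k0 (Γ.ex (as m) (f m)) m).mono (past_mono (by omega)) le_rfl
  exact h1.sub h2

lemma mg_step (as : ℕ → Γ.A) (f : ℕ → Γ.K → ℝ) {C : ℝ} (hf : ∀ m k, |f m k| ≤ C) (k0 : Γ.K)
    (N : ℕ) (x : ℝ) : |Γ.mg as f k0 (N + 1) x - Γ.mg as f k0 N x| ≤ 2 * C := by
  rw [mg, mg, Finset.sum_range_succ, add_sub_cancel_left]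
  have h1 := hf N (Γ.st as k0 x (N + 1))
  have h2 := Γ.ex_abs_le (as N) (hf N) (Γ.st as k0 x N)
  rw [abs_le] at *
  constructor <;> linarith

lemma mg_bdd (as : ℕ → Γ.A) (f : ℕ → Γ.K → ℝ) {C : ℝ} (hf : ∀ m k, |f m k| ≤ C) (k0 : Γ.K)
    (N : ℕ) (x : ℝ) : |Γ.mg as f k0 N x| ≤ 2 * C * N := by
  induction N with
  | zero => simp [mg]
  | succ N ih =>
    have h := Γ.mg_step as f hf k0 N x
    have h2 : |Γ.mg as f k0 (N + 1) x| ≤ |Γ.mg as f k0 (N + 1) x - Γ.mg as f k0 N x|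
      + |Γ.mg as f k0 N x| := by
      have := abs_add_le (Γ.mg as f k0 (N + 1) x - Γ.mg as f k0 N x) (Γ.mg as f k0 N x)
      simpa using this
    push_cast; linarith

lemma mg_meas (as : ℕ → Γ.A) (f : ℕ → Γ.K → ℝ) (k0 : Γ.K) (N : ℕ) :
    Measurable (Γ.mg as f k0 N) := (Γ.mg_past as f k0 N).mono (past_le N) le_rfl

lemma comp_meas (as : ℕ → Γ.A) (k0 : Γ.K) (f : Γ.K → ℝ) (m : ℕ) :
    Measurable (fun x => f (Γ.st as k0 x m)) := (Γ.comp_past as k0 f m).mono (past_le m) le_rfl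

lemma mg_sq_int (as : ℕ → Γ.A) (f : ℕ → Γ.K → ℝ) {C : ℝ} (hf : ∀ m k, |f m k| ≤ C) (k0 : Γ.K)
    (N : ℕ) : Integrable (fun x => Γ.mg as f k0 N x ^ 2) lam := by
  refine integrable_of_bdd ((Γ.mg_meas as f k0 N).pow_const 2) (C := (2 * C * N) ^ 2) fun x => ?_
  rw [abs_pow]
  exact pow_le_pow_left₀ (abs_nonneg _) (Γ.mg_bdd as f hf k0 N x) 2

lemma mg_var (as : ℕ → Γ.A) (f : ℕ → Γ.K → ℝ) {C : ℝ} (hf : ∀ m k, |f m k| ≤ C) (k0 : Γ.K)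
    (N : ℕ) : ∫ x, Γ.mg as f k0 N x ^ 2 ∂lam ≤ (2 * C) ^ 2 * N := by
  induction N with
  | zero => simp [mg]
  | succ N ih =>
    let M := Γ.mg as f k0 N
    let X : ℝ → ℝ := fun x => f N (Γ.st as k0 x (N + 1))
    let Y : ℝ → ℝ := fun x => Γ.ex (as N) (f N) (Γ.st as k0 x N)
    have hM : ∀ x, |M x| ≤ 2 * C * N := Γ.mg_bdd as f hf k0 N
    have hMm : Measurable M := Γ.mg_meas as f k0 N
    have hXm : Measurable X := Γ.comp_meas as k0 (f N) (N + 1)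
    have hYm : Measurable Y := Γ.comp_meas as k0 _ N
    have hX : ∀ x, |X x| ≤ C := fun x => hf _ _
    have hY : ∀ x, |Y x| ≤ C := fun x => Γ.ex_abs_le _ (hf N) _
    have hortho : ∫ x, M x * X x ∂lam = ∫ x, M x * Y x ∂lam :=
      Γ.cond_step as k0 N M (Γ.mg_past as f k0 N) ⟨_, hM⟩ (f N)
    have i1 : Integrable (fun x => M x * X x) lam :=
      integrable_of_bdd (hMm.mul hXm) (C := 2 * C * N * C) fun x => by
        rw [abs_mul]; exact mul_le_mul (hM x) (hX x) (abs_nonneg _) ((abs_nonneg _).trans (hM x))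
    have i2 : Integrable (fun x => M x * Y x) lam :=
      integrable_of_bdd (hMm.mul hYm) (C := 2 * C * N * C) fun x => by
        rw [abs_mul]; exact mul_le_mul (hM x) (hY x) (abs_nonneg _) ((abs_nonneg _).trans (hM x))
    have i3 : Integrable (fun x => M x ^ 2) lam := Γ.mg_sq_int as f hf k0 N
    have hle : ∀ x, Γ.mg as f k0 (N + 1) x ^ 2
        ≤ M x ^ 2 + 2 * (M x * X x - M x * Y x) + (2 * C) ^ 2 := by
      intro x
      have e : Γ.mg as f k0 (N + 1) x = M x + (X x - Y x) := Finset.sum_range_succ _ _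
      have h := Γ.mg_step as f hf k0 N x
      have h2 : (X x - Y x) ^ 2 ≤ (2 * C) ^ 2 := by
        rw [e] at h
        have : M x + (X x - Y x) - Γ.mg as f k0 N x = X x - Y x := by simp [M]
        rw [this] at h
        rw [← sq_abs]
        exact pow_le_pow_left₀ (abs_nonneg _) h 2
      rw [e]; nlinarith
    have i4 : Integrable (fun x => M x ^ 2 + 2 * (M x * X x - M x * Y x) + (2 * C) ^ 2) lam :=
      (i3.add ((i1.sub i2).const_mul 2)).add (integrable_const _)
    have hI := integral_mono (Γ.mg_sq_int as f hf k0 (N + 1)) i4 hle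
    have i6 : Integrable (fun x => 2 * (M x * X x - M x * Y x)) lam := (i1.sub i2).const_mul 2
    have i5 : Integrable (fun x => M x ^ 2 + 2 * (M x * X x - M x * Y x)) lam := i3.add i6
    rw [integral_add i5 (integrable_const _),
      integral_add i3 i6, integral_const_mul, integral_sub i1 i2, hortho] at hI
    simp only [sub_self, mul_zero, add_zero, integral_const, probReal_univ, smul_eq_mul, one_mul]
      at hI
    push_cast
    have : ∫ x, M x ^ 2 ∂lam ≤ (2 * C) ^ 2 * N := ih
    linarith

lemma mg_slln (as : ℕ → Γ.A) (f : ℕ → Γ.K → ℝ) {C : ℝ} (hf : ∀ m k, |f m k| ≤ C) (k0 : Γ.K) :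
    ∀ᵐ x ∂lam, Tendsto (fun N : ℕ => Γ.mg as f k0 N x / N) atTop (nhds 0) := by
  have hZm : ∀ i : ℕ, Measurable (fun x => ENNReal.ofReal
      ((Γ.mg as f k0 (i ^ 2) x / (i : ℝ) ^ 2) ^ 2)) := fun i =>
    (((Γ.mg_meas as f k0 (i ^ 2)).div_const _).pow_const 2).ennreal_ofReal
  have hZ : ∀ i : ℕ, ∫⁻ x, ENNReal.ofReal ((Γ.mg as f k0 (i ^ 2) x / (i : ℝ) ^ 2) ^ 2) ∂lam
      ≤ ENNReal.ofReal ((2 * C) ^ 2 * (1 / (i : ℝ) ^ 2)) := by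
    intro i
    have hi : Integrable (fun x => (Γ.mg as f k0 (i ^ 2) x / (i : ℝ) ^ 2) ^ 2) lam := by
      simp only [div_pow]
      exact (Γ.mg_sq_int as f hf k0 (i ^ 2)).div_const _
    rw [← ofReal_integral_eq_lintegral_ofReal hi (ae_of_all _ fun x => sq_nonneg _)]
    apply ENNReal.ofReal_le_ofReal
    simp only [div_pow]
    rw [integral_div]
    have h := Γ.mg_var as f hf k0 (i ^ 2)
    rcases Nat.eq_zero_or_pos i with h0 | h0
    · simp [h0]
    · have : (0 : ℝ) < i := by exact_mod_cast h0
      rw [div_le_iff₀ (by positivity)]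
      push_cast at h
      refine h.trans (le_of_eq ?_)
      field_simp
  have hsum : ∑' i : ℕ, ENNReal.ofReal ((2 * C) ^ 2 * (1 / (i : ℝ) ^ 2)) ≠ ⊤ := by
    have hs : Summable (fun i : ℕ => (2 * C) ^ 2 * (1 / (i : ℝ) ^ 2)) :=
      (Real.summable_one_div_nat_pow.2 (by norm_num)).mul_left _
    rw [← ENNReal.ofReal_tsum_of_nonneg (fun i => by positivity) hs]
    exact ENNReal.ofReal_ne_top
  have hfin : ∫⁻ x, ∑' i : ℕ, ENNReal.ofReal ((Γ.mg as f k0 (i ^ 2) x / (i : ℝ) ^ 2) ^ 2) ∂lam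
      ≠ ⊤ := by
    rw [lintegral_tsum fun i => (hZm i).aemeasurable]
    exact ne_top_of_le_ne_top hsum (ENNReal.tsum_le_tsum hZ)
  filter_upwards [ae_lt_top (Measurable.ennreal_tsum hZm) hfin] with x hx
  refine fill_gaps _ (2 * C) (fun n => Γ.mg_step as f hf k0 n x) ?_
  have h1 := ENNReal.tendsto_atTop_zero_of_tsum_ne_top hx.ne
  have h2 := (ENNReal.tendsto_toReal ENNReal.zero_ne_top).comp h1
  simp only [Function.comp_def, ENNReal.toReal_zero, ENNReal.toReal_ofReal (sq_nonneg _)] at h2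
  have h3 := h2.sqrt
  simp only [Real.sqrt_sq_eq_abs, Real.sqrt_zero] at h3
  exact (tendsto_zero_iff_abs_tendsto_zero _).2 h3

lemma st_pos (as : ℕ → Γ.A) (k0 : Γ.K) :
    ∀ᵐ x ∂lam, ∀ m, 0 < Γ.tr (as m) (Γ.st as k0 x m) (Γ.st as k0 x (m + 1)) := by
  classical
  rw [ae_all_iff]
  intro m
  have key : ∀ k k', Γ.tr (as m) k k' = 0 →
      ∀ᵐ x ∂lam, ¬ (Γ.st as k0 x m = k ∧ Γ.st as k0 x (m + 1) = k') := by
    intro k k' h0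
    let ψ : ℝ → ℝ := fun x => (fun j => if j = k then (1 : ℝ) else 0) (Γ.st as k0 x m)
    let φ : Γ.K → ℝ := fun j => if j = k' then (1 : ℝ) else 0
    have h := Γ.cond_step as k0 m ψ (Γ.comp_past as k0 (fun j => if j = k then (1 : ℝ) else 0) m)
      ⟨1, fun x => by simp only [ψ]; split_ifs <;> simp⟩ φ
    have hz : ∀ x, ψ x * Γ.ex (as m) φ (Γ.st as k0 x m) = 0 := by
      intro x
      by_cases hk : Γ.st as k0 x m = k
      · rw [hk]; simp [ex, φ, h0]
      · simp [ψ, hk]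
    simp only [hz, integral_zero] at h
    have hψm : Measurable ψ := Γ.comp_meas as k0 (fun j => if j = k then (1 : ℝ) else 0) m
    have hφm : Measurable (fun x => φ (Γ.st as k0 x (m + 1))) := Γ.comp_meas as k0 φ (m + 1)
    rw [integral_eq_zero_iff_of_nonneg] at h
    · filter_upwards [h] with x hx
      rintro ⟨h1, h2⟩
      simp [ψ, φ, h1, h2] at hx
    · intro x; simp only [ψ, φ, Pi.zero_apply]; split_ifs <;> simp
    · refine integrable_of_bdd (hψm.mul hφm) (C := 1) fun x => ?_
      simp only [ψ, φ]; split_ifs <;> simp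
  have key2 : ∀ᵐ x ∂lam, ∀ k k', Γ.tr (as m) k k' = 0 →
      ¬ (Γ.st as k0 x m = k ∧ Γ.st as k0 x (m + 1) = k') := by
    rw [ae_all_iff]; intro k; rw [ae_all_iff]; intro k'
    by_cases h0 : Γ.tr (as m) k k' = 0
    · filter_upwards [key k k' h0] with x hx _ using hx
    · exact ae_of_all _ fun x h => absurd h h0
  filter_upwards [key2] with x hx
  refine lt_of_le_of_ne (Γ.tr_nonneg _ _ _) fun h => hx _ _ h.symm ⟨rfl, rfl⟩

end POMDP

namespace POMDP
variable (Γ : POMDP)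

/-- shift of a sequence of actions -/
def sh (τ : ℕ → Γ.A) : ℕ → Γ.A := fun n => τ (n + 1)

lemma sh_iter (τ : ℕ → Γ.A) (s : ℕ) : Γ.sh^[s] τ = fun n => τ (n + s) := by
  induction s with
  | zero => rfl
  | succ s ih => rw [Function.iterate_succ_apply', ih]; funext n; simp only [sh]; congr 1; omega

/-- expected total payoff -/
def Sn : ℕ → (ℕ → Γ.A) → Γ.K → ℝ
  | 0, _, _ => 0
  | n + 1, τ, k => Γ.g k (τ 0) + Γ.ex (τ 0) (Sn n (Γ.sh τ)) k

lemma Sn_nonneg (n : ℕ) (τ : ℕ → Γ.A) (k : Γ.K) : 0 ≤ Γ.Sn n τ k := by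
  induction n generalizing τ k with
  | zero => simp [Sn]
  | succ n ih =>
    rw [Sn]
    refine add_nonneg (Γ.g_nonneg _ _) (Finset.sum_nonneg fun k' _ => ?_)
    exact mul_nonneg (Γ.tr_nonneg _ _ _) (ih _ _)

lemma Sn_succ_ge (n : ℕ) (τ : ℕ → Γ.A) (k : Γ.K) : Γ.Sn n τ k ≤ Γ.Sn (n + 1) τ k := by
  induction n generalizing τ k with
  | zero => rw [Sn]; exact Γ.Sn_nonneg _ _ _
  | succ n ih =>
    rw [Sn, Sn]
    exact add_le_add le_rfl (Γ.ex_mono _ (fun k' => ih _ _) _)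

lemma Sn_succ_le (n : ℕ) (τ : ℕ → Γ.A) (k : Γ.K) : Γ.Sn (n + 1) τ k ≤ Γ.Sn n τ k + 1 := by
  induction n generalizing τ k with
  | zero =>
    rw [Sn, Sn]
    have : Γ.ex (τ 0) (Γ.Sn 0 (Γ.sh τ)) k = 0 := Γ.ex_const (τ 0) 0 k
    rw [this]; linarith [Γ.g_le_one k (τ 0)]
  | succ n ih =>
    have e1 : Γ.Sn (n + 1 + 1) τ k = Γ.g k (τ 0) + Γ.ex (τ 0) (Γ.Sn (n + 1) (Γ.sh τ)) k := rfl
    have e2 : Γ.Sn (n + 1) τ k = Γ.g k (τ 0) + Γ.ex (τ 0) (Γ.Sn n (Γ.sh τ)) k := rfl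
    rw [e1, e2]
    have := Γ.ex_mono (τ 0) (fun k' => ih (Γ.sh τ) k') k
    rw [Γ.ex_add_const] at this
    linarith

lemma Sn_le (n : ℕ) (τ : ℕ → Γ.A) (k : Γ.K) : Γ.Sn n τ k ≤ n := by
  induction n with
  | zero => simp [Sn]
  | succ n ih => push_cast; linarith [Γ.Sn_succ_le n τ k]

lemma Sn_add_le (n t : ℕ) (τ : ℕ → Γ.A) (k : Γ.K) : Γ.Sn (n + t) τ k ≤ Γ.Sn n τ k + t := by
  induction t with
  | zero => simp
  | succ t ih => rw [← add_assoc]; push_cast; linarith [Γ.Sn_succ_le (n + t) τ k]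

lemma ex_Sn (n : ℕ) (τ : ℕ → Γ.A) (k : Γ.K) :
    Γ.Sn n τ k - 1 ≤ Γ.ex (τ 0) (Γ.Sn n (Γ.sh τ)) k := by
  have h1 := Γ.Sn_succ_ge n τ k
  rw [Sn] at h1
  linarith [Γ.g_le_one k (τ 0)]

lemma cont_act {β : Type*} [TopologicalSpace β] (f : Γ.A → β) (i : ℕ) :
    Continuous (fun τ : ℕ → Γ.A => f (τ i)) :=
  (continuous_of_discreteTopology (f := f)).comp (continuous_apply i)

lemma cont_sh : Continuous Γ.sh := continuous_pi fun n => continuous_apply (n + 1)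

lemma cont_Sn (n : ℕ) (k : Γ.K) : Continuous (fun τ => Γ.Sn n τ k) := by
  induction n generalizing k with
  | zero => simp only [Sn]; exact continuous_const
  | succ n ih =>
    simp only [Sn, ex]
    refine (Γ.cont_act (fun a => Γ.g k a) 0).add (continuous_finsetSum _ fun k' _ => ?_)
    exact (Γ.cont_act (fun a => Γ.tr a k k') 0).mul ((ih k').comp Γ.cont_sh)

/-- belief and sequence of actions -/
abbrev X := (Γ.K → ℝ) × (ℕ → Γ.A)

/-- dynamics -/
def F (x : Γ.X) : Γ.X := (fun k' => ∑ k, x.1 k * Γ.tr (x.2 0) k k', Γ.sh x.2)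

/-- stage payoff -/
def u (x : Γ.X) : ℝ := ∑ k, x.1 k * Γ.g k (x.2 0)

/-- normalised payoff -/
noncomputable def An (n : ℕ) (τ : ℕ → Γ.A) (k : Γ.K) : ℝ := Γ.Sn n τ k / n

/-- energy -/
noncomputable def En (n : ℕ) (x : Γ.X) : ℝ := ∑ k, x.1 k * (Γ.An n x.2 k) ^ 2

/-- energy increment -/
noncomputable def Dn (n : ℕ) (x : Γ.X) : ℝ :=
  ∑ k, x.1 k * ∑ k', Γ.tr (x.2 0) k k' * (Γ.An n (Γ.sh x.2) k' - Γ.An n x.2 k) ^ 2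

lemma An_nonneg (n : ℕ) (τ : ℕ → Γ.A) (k : Γ.K) : 0 ≤ Γ.An n τ k :=
  div_nonneg (Γ.Sn_nonneg _ _ _) (Nat.cast_nonneg _)

lemma An_le (n : ℕ) (τ : ℕ → Γ.A) (k : Γ.K) : Γ.An n τ k ≤ 1 :=
  div_le_one_of_le₀ (Γ.Sn_le _ _ _) (Nat.cast_nonneg _)

lemma cont_An (n : ℕ) (k : Γ.K) : Continuous (fun τ => Γ.An n τ k) := (Γ.cont_Sn n k).div_const _

lemma cont_F : Continuous Γ.F := by
  refine Continuous.prodMk (continuous_pi fun k' => continuous_finsetSum _ fun k _ => ?_)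
    (Γ.cont_sh.comp continuous_snd)
  exact ((continuous_apply k).comp continuous_fst).mul
    ((Γ.cont_act (fun a => Γ.tr a k k') 0).comp continuous_snd)

lemma cont_u : Continuous Γ.u := by
  refine continuous_finsetSum _ fun k _ => ?_
  exact ((continuous_apply k).comp continuous_fst).mul
    ((Γ.cont_act (fun a => Γ.g k a) 0).comp continuous_snd)

lemma cont_Dn (n : ℕ) : Continuous (Γ.Dn n) := by
  refine continuous_finsetSum _ fun k _ => ?_
  refine ((continuous_apply k).comp continuous_fst).mul (continuous_finsetSum _ fun k' _ => ?_)
  refine ((Γ.cont_act (fun a => Γ.tr a k k') 0).comp continuous_snd).mul ?_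
  exact (((Γ.cont_An n k').comp (Γ.cont_sh.comp continuous_snd)).sub
    ((Γ.cont_An n k).comp continuous_snd)).pow 2

lemma F_belief {x : Γ.X} (h : IsBelief x.1) : IsBelief (Γ.F x).1 := by
  refine ⟨fun k' => ?_, ?_⟩
  · change 0 ≤ ∑ k, x.1 k * Γ.tr (x.2 0) k k'
    exact Finset.sum_nonneg fun k _ => mul_nonneg (h.1 k) (Γ.tr_nonneg (x.2 0) k k')
  simp only [F]
  rw [Finset.sum_comm]
  simp only [← Finset.mul_sum, tr_sum, mul_one]
  exact h.2

lemma Fi_belief {x : Γ.X} (h : IsBelief x.1) (m : ℕ) : IsBelief (Γ.F^[m] x).1 := by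
  induction m with
  | zero => exact h
  | succ m ih => rw [Function.iterate_succ_apply']; exact Γ.F_belief ih

lemma Fi_snd (x : Γ.X) (m : ℕ) : (Γ.F^[m] x).2 = fun n => x.2 (n + m) := by
  induction m with
  | zero => rfl
  | succ m ih =>
    rw [Function.iterate_succ_apply']
    funext n
    simp only [F, sh, ih]; exact congrArg x.2 (by omega)

lemma sum_F (x : Γ.X) (f : Γ.K → ℝ) :
    ∑ k, (Γ.F x).1 k * f k = ∑ k, x.1 k * Γ.ex (x.2 0) f k := by
  simp only [F, ex, Finset.sum_mul, Finset.mul_sum]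
  rw [Finset.sum_comm]
  refine Finset.sum_congr rfl fun k _ => Finset.sum_congr rfl fun k' _ => by ring

lemma sum_Sn (n : ℕ) (x : Γ.X) :
    ∑ k, x.1 k * Γ.Sn n x.2 k = ∑ i ∈ Finset.range n, Γ.u (Γ.F^[i] x) := by
  induction n generalizing x with
  | zero => simp [Sn]
  | succ n ih =>
    rw [Finset.sum_range_succ']
    simp only [Function.iterate_succ_apply]
    rw [← ih (Γ.F x), Γ.sum_F]
    simp only [Sn, mul_add, Finset.sum_add_distrib, u, F, Function.iterate_zero, id]
    ring

lemma u_nonneg {x : Γ.X} (h : IsBelief x.1) : 0 ≤ Γ.u x :=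
  Finset.sum_nonneg fun k _ => mul_nonneg (h.1 k) (Γ.g_nonneg _ _)

lemma u_le {x : Γ.X} (h : IsBelief x.1) : Γ.u x ≤ 1 := by
  rw [← h.2]
  exact Finset.sum_le_sum fun k _ => mul_le_of_le_one_right (h.1 k) (Γ.g_le_one _ _)

lemma En_nonneg (n : ℕ) {x : Γ.X} (h : IsBelief x.1) : 0 ≤ Γ.En n x :=
  Finset.sum_nonneg fun k _ => mul_nonneg (h.1 k) (sq_nonneg _)

lemma En_le (n : ℕ) {x : Γ.X} (h : IsBelief x.1) : Γ.En n x ≤ 1 := by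
  rw [← h.2]
  exact Finset.sum_le_sum fun k _ => mul_le_of_le_one_right (h.1 k)
    (pow_le_one₀ (Γ.An_nonneg _ _ _) (Γ.An_le _ _ _))

lemma Dn_nonneg (n : ℕ) {x : Γ.X} (h : IsBelief x.1) : 0 ≤ Γ.Dn n x :=
  Finset.sum_nonneg fun k _ => mul_nonneg (h.1 k)
    (Finset.sum_nonneg fun k' _ => mul_nonneg (Γ.tr_nonneg _ _ _) (sq_nonneg _))

lemma Dn_le (n : ℕ) (hn : 0 < n) {x : Γ.X} (h : IsBelief x.1) :
    Γ.Dn n x ≤ Γ.En n (Γ.F x) - Γ.En n x + 2 / n := by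
  have hn' : (0 : ℝ) < n := by exact_mod_cast hn
  have h1 : ∀ k, ∑ k', Γ.tr (x.2 0) k k' * (Γ.An n (Γ.sh x.2) k' - Γ.An n x.2 k) ^ 2
      ≤ Γ.ex (x.2 0) (fun k' => Γ.An n (Γ.sh x.2) k' ^ 2) k - Γ.An n x.2 k ^ 2 + 2 / n := by
    intro k
    have e : ∑ k', Γ.tr (x.2 0) k k' * (Γ.An n (Γ.sh x.2) k' - Γ.An n x.2 k) ^ 2
      = Γ.ex (x.2 0) (fun k' => Γ.An n (Γ.sh x.2) k' ^ 2) k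
        - 2 * Γ.An n x.2 k * (Γ.ex (x.2 0) (Γ.An n (Γ.sh x.2)) k)
        + Γ.An n x.2 k ^ 2 * ∑ k', Γ.tr (x.2 0) k k' := by
      simp only [ex, Finset.mul_sum]
      rw [← Finset.sum_sub_distrib, ← Finset.sum_add_distrib]
      exact Finset.sum_congr rfl fun k' _ => by ring
    have h2 : Γ.An n x.2 k - 1 / n ≤ Γ.ex (x.2 0) (Γ.An n (Γ.sh x.2)) k := by
      have h3 := Γ.ex_Sn n x.2 k
      have e2 : Γ.ex (x.2 0) (Γ.An n (Γ.sh x.2)) k = Γ.ex (x.2 0) (Γ.Sn n (Γ.sh x.2)) k / n := by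
        simp only [ex, An, Finset.sum_div, mul_div_assoc]
      rw [e2, An, ← sub_div]
      exact div_le_div_of_nonneg_right h3 hn'.le
    rw [e, tr_sum]
    have h4 := Γ.An_nonneg n x.2 k
    have h5 := Γ.An_le n x.2 k
    have h6 := mul_le_mul_of_nonneg_left h2 h4
    have h7 : Γ.An n x.2 k * (1 / n) ≤ 1 / n := mul_le_of_le_one_left (by positivity) h5
    have h8 : (2 : ℝ) / n = 2 * (1 / n) := by ring
    rw [h8]
    nlinarith
  have h9 := Γ.sum_F x (fun k' => Γ.An n (Γ.sh x.2) k' ^ 2)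
  have h10 : Γ.En n (Γ.F x) = ∑ k, x.1 k * Γ.ex (x.2 0) (fun k' => Γ.An n (Γ.sh x.2) k' ^ 2) k := h9
  rw [h10, En]
  calc Γ.Dn n x ≤ ∑ k, x.1 k * (Γ.ex (x.2 0) (fun k' => Γ.An n (Γ.sh x.2) k' ^ 2) k
        - Γ.An n x.2 k ^ 2 + 2 / n) :=
        Finset.sum_le_sum fun k _ => mul_le_mul_of_nonneg_left (h1 k) (h.1 k)
    _ = _ := by
      simp only [mul_add, mul_sub, Finset.sum_add_distrib, Finset.sum_sub_distrib]
      rw [← Finset.sum_mul, h.2, one_mul]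

lemma Dn_sum (n : ℕ) (hn : 0 < n) {x : Γ.X} (h : IsBelief x.1) (s M : ℕ) :
    ∑ m ∈ Finset.range M, Γ.Dn n (Γ.F^[m + s] x) ≤ 1 + 2 / n * M := by
  have key : ∑ m ∈ Finset.range M, Γ.Dn n (Γ.F^[m + s] x)
      ≤ Γ.En n (Γ.F^[M + s] x) - Γ.En n (Γ.F^[s] x) + 2 / n * M := by
    induction M with
    | zero => simp
    | succ M ih =>
      rw [Finset.sum_range_succ]
      have h1 := Γ.Dn_le n hn (Γ.Fi_belief h (M + s))
      rw [← Function.iterate_succ_apply' Γ.F] at h1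
      have e : M + 1 + s = (M + s).succ := by omega
      rw [e]; push_cast; linarith
  have h2 := Γ.En_le n (Γ.Fi_belief h (M + s))
  have h3 := Γ.En_nonneg n (Γ.Fi_belief h s)
  linarith

end POMDP

/-- Riesz-type counting lemma. -/
lemma riesz (u : ℕ → ℝ) (h1 : ∀ m, u m ≤ 1) (c : ℝ) (hc : 0 ≤ c) (N : ℕ)
    (G : ℕ → ℝ) (hG0 : ∀ m, 0 ≤ G m)
    (hG : ∀ m, G m < 1 → ∃ n, 1 ≤ n ∧ n ≤ N ∧ ∑ i ∈ Finset.range n, u (m + i) < c * n) (M : ℕ) :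
    ∀ s, ∑ m ∈ Finset.range M, u (s + m) ≤ c * M + ∑ m ∈ Finset.range M, G (s + m) + N := by
  induction M using Nat.strong_induction_on with
  | _ M ih =>
    intro s
    rcases Nat.eq_zero_or_pos M with rfl | hM
    · simp
    by_cases hs : G s < 1
    · obtain ⟨n, hn1, hnN, hn⟩ := hG s hs
      rcases le_or_gt n M with hnM | hnM
      · obtain ⟨M', rfl⟩ := Nat.exists_eq_add_of_le hnM
        have := ih M' (by omega) (s + n)
        rw [Finset.sum_range_add, Finset.sum_range_add (fun m => G (s + m))]
        have hg : 0 ≤ ∑ m ∈ Finset.range n, G (s + m) := Finset.sum_nonneg fun _ _ => hG0 _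
        simp only [add_assoc] at this ⊢
        push_cast
        linarith
      · have hg : 0 ≤ ∑ m ∈ Finset.range M, G (s + m) := Finset.sum_nonneg fun _ _ => hG0 _
        have hu : ∑ m ∈ Finset.range M, u (s + m) ≤ ∑ m ∈ Finset.range M, (1 : ℝ) :=
          Finset.sum_le_sum fun _ _ => h1 _
        simp only [Finset.sum_const, Finset.card_range, nsmul_eq_mul, mul_one] at hu
        have : (M : ℝ) ≤ N := by exact_mod_cast (by omega : M ≤ N)
        have : 0 ≤ c * M := by positivity
        linarith
    · obtain ⟨M', rfl⟩ : ∃ M', M = M' + 1 := ⟨M - 1, by omega⟩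
      have := ih M' (by omega) (s + 1)
      rw [Finset.sum_range_succ', Finset.sum_range_succ' (fun m => G (s + m))]
      have e : ∀ f : ℕ → ℝ, ∑ m ∈ Finset.range M', f (s + (m + 1))
          = ∑ m ∈ Finset.range M', f (s + 1 + m) := fun f =>
        Finset.sum_congr rfl fun m _ => congrArg f (by omega)
      rw [e, e]
      simp only [add_zero]
      push_cast
      push Not at hs
      linarith [h1 s]



lemma exists_nn (δ : ℝ) (hδ : 0 < δ) : ∃ nn : ℕ → ℕ, (∀ j, 0 < nn j) ∧ StrictMono nn ∧
    ∀ J, ∑ j ∈ Finset.range J, ((j : ℝ) + 1) * ((j + 1) * (2 / nn j)) ≤ δ := by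
  obtain ⟨n0, hn0⟩ := exists_nat_gt (4 / δ)
  have hn0' : (0 : ℝ) < n0 := lt_trans (by positivity) hn0
  have hn0p : 0 < n0 := by exact_mod_cast hn0'
  refine ⟨fun j => n0 * 8 ^ j, fun j => by positivity, ?_, fun J => ?_⟩
  · intro a b hab
    exact Nat.mul_lt_mul_of_pos_left (Nat.pow_lt_pow_right (by norm_num) hab) hn0p
  · have h1 : ∀ j : ℕ, ((j : ℝ) + 1) * ((j + 1) * (2 / ((n0 * 8 ^ j : ℕ) : ℝ)))
        ≤ 2 / n0 * (1 / 2) ^ j := by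
      intro j
      have h2 : ((j : ℝ) + 1) ≤ 2 ^ j := by exact_mod_cast Nat.lt_two_pow_self (n := j)
      have h3 : ((j : ℝ) + 1) * (j + 1) ≤ 2 ^ j * 2 ^ j := by gcongr
      push_cast
      have e : ((8 : ℝ)) ^ j = 2 ^ j * 2 ^ j * 2 ^ j := by
        rw [← mul_pow, ← mul_pow]; norm_num
      rw [e, ← mul_assoc, one_div, inv_pow]
      calc ((j : ℝ) + 1) * (j + 1) * (2 / (n0 * (2 ^ j * 2 ^ j * 2 ^ j)))
          ≤ 2 ^ j * 2 ^ j * (2 / (n0 * (2 ^ j * 2 ^ j * 2 ^ j))) := by gcongr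
        _ = 2 / n0 * (2 ^ j)⁻¹ := by field_simp
    refine (Finset.sum_le_sum fun j _ => h1 j).trans ?_
    rw [← Finset.mul_sum]
    have h4 : ∑ j ∈ Finset.range J, ((1 : ℝ) / 2) ^ j ≤ 2 := by
      have := Summable.sum_le_tsum (f := fun j : ℕ => ((1 : ℝ) / 2) ^ j) (Finset.range J)
        (fun _ _ => by positivity) summable_geometric_two
      rwa [tsum_geometric_two] at this
    have h5 : 4 / n0 < δ := by
      rw [div_lt_iff₀ hδ] at hn0
      rw [div_lt_iff₀ hn0']; linarith
    calc 2 / (n0 : ℝ) * _ ≤ 2 / n0 * 2 := by gcongr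
      _ ≤ δ := by have : 2 / (n0 : ℝ) * 2 = 4 / n0 := by ring
                  linarith

namespace POMDP
variable (Γ : POMDP)

lemma select {x0 : Γ.X} (h0 : IsBelief x0.1) (c δ : ℝ) (hc : 0 ≤ c) (hδ : 0 < δ)
    (hu : ∀ M0 : ℕ, ∃ M ≥ M0, (c + δ) * M ≤ ∑ m ∈ Finset.range M, Γ.u (Γ.F^[m] x0))
    (nn : ℕ → ℕ) (hnn : ∀ j, 0 < nn j)
    (hs : ∀ J, ∑ j ∈ Finset.range J, ((j : ℝ) + 1) * ((j + 1) * (2 / nn j)) ≤ δ / 2) (J : ℕ) :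
    ∃ m, (∀ n, 1 ≤ n → n ≤ J → c * n ≤ ∑ i ∈ Finset.range n, Γ.u (Γ.F^[m + i] x0)) ∧
      ∀ j ≤ J, ∀ s ≤ j, Γ.Dn (nn j) (Γ.F^[m + s] x0) ≤ 1 / (j + 1) := by
  by_contra hcon
  push Not at hcon
  let cost : ℕ → ℝ := fun m => ∑ j ∈ Finset.range (J + 1), ((j : ℝ) + 1) *
    ∑ s ∈ Finset.range (j + 1), Γ.Dn (nn j) (Γ.F^[m + s] x0)
  have hD : ∀ j m, 0 ≤ Γ.Dn (nn j) (Γ.F^[m] x0) := fun j m => Γ.Dn_nonneg _ (Γ.Fi_belief h0 m)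
  have hin : ∀ (j m : ℕ), 0 ≤ ((j : ℝ) + 1) *
      ∑ s ∈ Finset.range (j + 1), Γ.Dn (nn j) (Γ.F^[m + s] x0) := fun j m =>
    mul_nonneg (by positivity) (Finset.sum_nonneg fun s _ => hD _ _)
  have hr := riesz (fun m => Γ.u (Γ.F^[m] x0)) (fun m => Γ.u_le (Γ.Fi_belief h0 m)) c hc J cost
    (fun m => Finset.sum_nonneg fun j _ => hin j m) (by
      intro m hm
      by_contra h
      push Not at h
      obtain ⟨j, hj, s, hs, hlt⟩ := hcon m h
      have h1 : Γ.Dn (nn j) (Γ.F^[m + s] x0)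
          ≤ ∑ s ∈ Finset.range (j + 1), Γ.Dn (nn j) (Γ.F^[m + s] x0) :=
        Finset.single_le_sum (f := fun s => Γ.Dn (nn j) (Γ.F^[m + s] x0))
          (fun s _ => hD _ _) (Finset.mem_range.2 (by omega))
      have h2 : ((j : ℝ) + 1) * ∑ s ∈ Finset.range (j + 1), Γ.Dn (nn j) (Γ.F^[m + s] x0)
          ≤ cost m :=
        Finset.single_le_sum (f := fun j : ℕ => ((j : ℝ) + 1) *
          ∑ s ∈ Finset.range (j + 1), Γ.Dn (nn j) (Γ.F^[m + s] x0))
          (fun j _ => hin j m) (Finset.mem_range.2 (by omega))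
      have hj1 : (0 : ℝ) < j + 1 := by positivity
      rw [div_lt_iff₀ hj1] at hlt
      have h3 := mul_le_mul_of_nonneg_left h1 hj1.le
      linarith)
  let CJ : ℝ := ∑ j ∈ Finset.range (J + 1), ((j : ℝ) + 1) * (j + 1)
  have hcost : ∀ M : ℕ, ∑ m ∈ Finset.range M, cost m ≤ CJ + δ / 2 * M := by
    intro M
    calc ∑ m ∈ Finset.range M, cost m
        = ∑ j ∈ Finset.range (J + 1), ((j : ℝ) + 1) * ∑ s ∈ Finset.range (j + 1),
            ∑ m ∈ Finset.range M, Γ.Dn (nn j) (Γ.F^[m + s] x0) := by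
          simp only [cost]
          rw [Finset.sum_comm]
          refine Finset.sum_congr rfl fun j _ => ?_
          rw [← Finset.mul_sum, Finset.sum_comm]
      _ ≤ ∑ j ∈ Finset.range (J + 1), ((j : ℝ) + 1) * ∑ s ∈ Finset.range (j + 1),
            (1 + 2 / (nn j : ℝ) * M) := by
          refine Finset.sum_le_sum fun j _ => mul_le_mul_of_nonneg_left ?_ (by positivity)
          exact Finset.sum_le_sum fun s _ => Γ.Dn_sum _ (hnn j) h0 s M
      _ = CJ + (∑ j ∈ Finset.range (J + 1), ((j : ℝ) + 1) * ((j + 1) * (2 / nn j))) * M := by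
          simp only [CJ, Finset.sum_const, Finset.card_range, nsmul_eq_mul, Finset.sum_mul]
          rw [← Finset.sum_add_distrib]
          refine Finset.sum_congr rfl fun j _ => ?_
          push_cast; ring
      _ ≤ _ := by gcongr; exact hs _
  obtain ⟨M0, hM0⟩ := exists_nat_gt ((CJ + J) / (δ / 2))
  obtain ⟨M, hM, hMu⟩ := hu M0
  have h1 := hr M 0
  simp only [zero_add] at h1
  have h2 := hcost M
  rw [div_lt_iff₀ (by positivity)] at hM0
  have h3 : (M0 : ℝ) ≤ M := by exact_mod_cast hM
  nlinarith

lemma limit_point {x0 : Γ.X} (h0 : IsBelief x0.1) (c δ : ℝ) (hc : 0 ≤ c) (hδ : 0 < δ)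
    (hu : ∀ M0 : ℕ, ∃ M ≥ M0, (c + δ) * M ≤ ∑ m ∈ Finset.range M, Γ.u (Γ.F^[m] x0)) :
    ∃ nn : ℕ → ℕ, (∀ j, 0 < nn j) ∧ StrictMono nn ∧ ∃ y : Γ.X, IsBelief y.1 ∧
      (∀ n : ℕ, c * n ≤ ∑ i ∈ Finset.range n, Γ.u (Γ.F^[i] y)) ∧
      (∀ j, ∀ s ≤ j, Γ.Dn (nn j) (Γ.F^[s] y) ≤ 1 / (j + 1)) ∧
      ∀ η > 0, ∃ m, ∑ k, |(Γ.F^[m] x0).1 k - y.1 k| < η := by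
  obtain ⟨nn, hnn, hmono, hs⟩ := exists_nn (δ / 2) (by positivity)
  choose m hm1 hm2 using Γ.select h0 c δ hc hδ hu nn hnn hs
  refine ⟨nn, hnn, hmono, ?_⟩
  have hcpt : IsCompact ((Set.univ.pi fun _ : Γ.K => Set.Icc (0 : ℝ) 1) ×ˢ
      (Set.univ : Set (ℕ → Γ.A))) :=
    (isCompact_univ_pi fun _ => isCompact_Icc).prod isCompact_univ
  have hmem : ∀ J, Γ.F^[m J] x0 ∈ ((Set.univ.pi fun _ : Γ.K => Set.Icc (0 : ℝ) 1) ×ˢ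
      (Set.univ : Set (ℕ → Γ.A))) := by
    intro J
    have hb := Γ.Fi_belief h0 (m J)
    refine ⟨fun k _ => ⟨hb.1 k, ?_⟩, trivial⟩
    rw [← hb.2]
    exact Finset.single_le_sum (fun k _ => hb.1 k) (Finset.mem_univ k)
  obtain ⟨y, -, φ, hφ, hy⟩ := hcpt.tendsto_subseq hmem
  have hF : ∀ s, Tendsto (fun J => Γ.F^[m (φ J) + s] x0) atTop (nhds (Γ.F^[s] y)) := by
    intro s
    have := ((Γ.cont_F.iterate s).tendsto y).comp hy
    refine this.congr fun J => ?_
    simp only [Function.comp]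
    rw [← Function.iterate_add_apply, add_comm]
  have hcoord : ∀ k, Tendsto (fun J => (Γ.F^[m (φ J)] x0).1 k) atTop (nhds (y.1 k)) := fun k =>
    (((continuous_apply k).comp continuous_fst).tendsto y).comp hy
  refine ⟨y, ⟨fun k => ?_, ?_⟩, fun n => ?_, fun j s hsj => ?_, fun η hη => ?_⟩
  · exact ge_of_tendsto' (hcoord k) fun J => (Γ.Fi_belief h0 _).1 k
  · refine tendsto_nhds_unique (tendsto_finsetSum _ fun k _ => hcoord k) ?_
    simp only [fun J => (Γ.Fi_belief h0 (m (φ J))).2]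
    exact tendsto_const_nhds
  · rcases Nat.eq_zero_or_pos n with rfl | hn
    · simp
    refine ge_of_tendsto (tendsto_finsetSum (f := fun i J => Γ.u (Γ.F^[m (φ J) + i] x0))
      (Finset.range n) fun i _ => (Γ.cont_u.tendsto _).comp (hF i)) ?_
    filter_upwards [eventually_ge_atTop n] with J hJ
    exact hm1 _ n hn (hJ.trans (hφ.id_le J))
  · refine le_of_tendsto ((Γ.cont_Dn (nn j)).tendsto _ |>.comp (hF s)) ?_
    filter_upwards [eventually_ge_atTop j] with J hJ
    exact hm2 _ j (hJ.trans (hφ.id_le J)) s hsj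
  · have h1 : Tendsto (fun J => ∑ k, |(Γ.F^[m (φ J)] x0).1 k - y.1 k|) atTop (nhds 0) := by
      have : Tendsto (fun J => ∑ k, |(Γ.F^[m (φ J)] x0).1 k - y.1 k|) atTop
          (nhds (∑ k, |y.1 k - y.1 k|)) :=
        tendsto_finsetSum _ fun k _ => ((hcoord k).sub_const _).abs
      simpa using this
    obtain ⟨J, hJ⟩ := (h1.eventually (gt_mem_nhds hη)).exists
    exact ⟨_, hJ⟩

end POMDP

namespace POMDP
variable (Γ : POMDP)

/-- states reachable from a state under a sequence of actions -/
def reach (τ : ℕ → Γ.A) (κ : Γ.K) : ℕ → Set Γ.K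
  | 0 => {κ}
  | s + 1 => {k' | ∃ k ∈ reach τ κ s, 0 < Γ.tr (τ s) k k'}

lemma Fi_act (y : Γ.X) (s : ℕ) : (Γ.F^[s] y).2 0 = y.2 s := by
  rw [Γ.Fi_snd]; simp

lemma reach_pos {y : Γ.X} (hy : IsBelief y.1) {κ : Γ.K} (hκ : 0 < y.1 κ) (s : ℕ) :
    ∀ k ∈ Γ.reach y.2 κ s, 0 < (Γ.F^[s] y).1 k := by
  induction s with
  | zero => rintro k rfl; exact hκ
  | succ s ih =>
    rintro k' ⟨k, hk, hpos⟩
    rw [Function.iterate_succ_apply']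
    change 0 < ∑ k, (Γ.F^[s] y).1 k * Γ.tr ((Γ.F^[s] y).2 0) k k'
    rw [Fi_act]
    refine Finset.sum_pos' (fun j _ => mul_nonneg ((Γ.Fi_belief hy s).1 j) (Γ.tr_nonneg _ _ _))
      ⟨k, Finset.mem_univ k, mul_pos (ih k hk) hpos⟩

lemma reach_conv {y : Γ.X} (hy : IsBelief y.1) {κ : Γ.K} (hκ : 0 < y.1 κ) (nn : ℕ → ℕ)
    (hD : ∀ j, ∀ s ≤ j, Γ.Dn (nn j) (Γ.F^[s] y) ≤ 1 / (j + 1)) (s : ℕ) :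
    ∀ k ∈ Γ.reach y.2 κ s, Tendsto (fun j => Γ.An (nn j) (fun n => y.2 (n + s)) k
      - Γ.An (nn j) y.2 κ) atTop (nhds 0) := by
  induction s with
  | zero => rintro k rfl; simp
  | succ s ih =>
    rintro k' ⟨k, hk, hpos⟩
    have hb := Γ.reach_pos hy hκ s k hk
    have hbel := Γ.Fi_belief hy s
    have hsh : Γ.sh (Γ.F^[s] y).2 = fun n => y.2 (n + (s + 1)) := by
      rw [Fi_snd]; funext n; exact congrArg y.2 (by omega)
    have hle : ∀ j ≥ s, (Γ.An (nn j) (fun n => y.2 (n + (s + 1))) k'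
        - Γ.An (nn j) (fun n => y.2 (n + s)) k) ^ 2
        ≤ ((Γ.F^[s] y).1 k * Γ.tr (y.2 s) k k')⁻¹ * (1 / ((j : ℝ) + 1)) := by
      intro j hj
      have h1 := hD j s hj
      have h2 : (Γ.F^[s] y).1 k * (Γ.tr (y.2 s) k k' *
          (Γ.An (nn j) (fun n => y.2 (n + (s + 1))) k'
            - Γ.An (nn j) (fun n => y.2 (n + s)) k) ^ 2) ≤ Γ.Dn (nn j) (Γ.F^[s] y) := by
        rw [Dn, Fi_act, hsh, Fi_snd]
        refine le_trans (mul_le_mul_of_nonneg_left ?_ hb.le)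
          (Finset.single_le_sum (fun i _ => mul_nonneg (hbel.1 i) (Finset.sum_nonneg fun l _ =>
            mul_nonneg (Γ.tr_nonneg _ _ _) (sq_nonneg _))) (Finset.mem_univ k))
        exact Finset.single_le_sum (f := fun k' => Γ.tr (y.2 s) k k' *
          (Γ.An (nn j) (fun n => y.2 (n + (s + 1))) k'
            - Γ.An (nn j) (fun n => y.2 (n + s)) k) ^ 2)
          (fun l _ => mul_nonneg (Γ.tr_nonneg _ _ _) (sq_nonneg _)) (Finset.mem_univ k')
      rw [← mul_assoc] at h2
      rw [inv_mul_eq_div, le_div_iff₀ (mul_pos hb hpos)]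
      linarith
    have hsq : Tendsto (fun j => (Γ.An (nn j) (fun n => y.2 (n + (s + 1))) k'
        - Γ.An (nn j) (fun n => y.2 (n + s)) k) ^ 2) atTop (nhds 0) := by
      refine squeeze_zero' (Eventually.of_forall fun j => sq_nonneg _)
        (eventually_atTop.2 ⟨s, hle⟩) ?_
      simpa using (tendsto_one_div_add_atTop_nhds_zero_nat (𝕜 := ℝ)).const_mul
        ((Γ.F^[s] y).1 k * Γ.tr (y.2 s) k k')⁻¹
    have h3 := hsq.sqrt
    simp only [Real.sqrt_sq_eq_abs, Real.sqrt_zero] at h3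
    have h4 := ((tendsto_zero_iff_abs_tendsto_zero _).2 h3).add (ih k hk)
    simpa using h4

lemma choose_period {y : Γ.X} (hy : IsBelief y.1) (c : ℝ) (nn : ℕ → ℕ) (hnn : ∀ j, 0 < nn j)
    (hmono : StrictMono nn)
    (hc : ∀ n : ℕ, c * n ≤ ∑ i ∈ Finset.range n, Γ.u (Γ.F^[i] y))
    (hD : ∀ j, ∀ s ≤ j, Γ.Dn (nn j) (Γ.F^[s] y) ≤ 1 / (j + 1)) (η : ℝ) (hη : 0 < η) :
    ∃ (t l : ℕ) (C : Γ.K → ℝ), 0 < l ∧ (∀ κ, 0 ≤ C κ) ∧ (∀ κ, C κ ≤ 1) ∧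
      c - η ≤ ∑ κ, y.1 κ * C κ ∧ ∀ κ, C κ ≠ 0 →
        Γ.reach y.2 κ t = Γ.reach y.2 κ (t + l) ∧
        ∀ k ∈ Γ.reach y.2 κ t, C κ * l ≤ Γ.Sn l (fun n => y.2 (n + t)) k := by
  classical
  obtain ⟨R, hR⟩ := Finite.exists_infinite_fiber
    (fun j : ℕ => fun κ : Γ.K => Γ.reach y.2 κ (nn j))
  rw [Set.infinite_coe_iff] at hR
  obtain ⟨j1, hj1⟩ := hR.nonempty
  set t := nn j1 with ht
  have hconv : ∀ᶠ j in atTop, ∀ κ, 0 < y.1 κ → ∀ k ∈ Γ.reach y.2 κ t,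
      Γ.An (nn j) y.2 κ - η / 2 ≤ Γ.An (nn j) (fun n => y.2 (n + t)) k := by
    rw [eventually_all]; intro κ
    by_cases hκ : 0 < y.1 κ
    swap
    · exact Eventually.of_forall fun j h => absurd h hκ
    have : ∀ᶠ j in atTop, ∀ k, k ∈ Γ.reach y.2 κ t →
      Γ.An (nn j) y.2 κ - η / 2 ≤ Γ.An (nn j) (fun n => y.2 (n + t)) k := by
      rw [eventually_all]; intro k
      by_cases hk : k ∈ Γ.reach y.2 κ t
      swap
      · exact Eventually.of_forall fun j h => absurd h hk
      have := (Γ.reach_conv hy hκ nn hD t k hk).eventually (lt_mem_nhds (by linarith : -(η / 2) < 0))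
      filter_upwards [this] with j hj _
      linarith
    filter_upwards [this] with j hj _ using hj
  have hnt : Tendsto (fun j => (nn j : ℝ)) atTop atTop :=
    tendsto_natCast_atTop_atTop.comp hmono.tendsto_atTop
  have hbig := hnt.eventually (eventually_ge_atTop ((t : ℝ) / (η / 2)))
  obtain ⟨J, hJ⟩ := eventually_atTop.1 (hconv.and (hbig.and (eventually_gt_atTop j1)))
  obtain ⟨j, hjR, hjJ⟩ := hR.exists_gt J
  obtain ⟨h1, h2, h3⟩ := hJ j hjJ.le
  have hlt : t < nn j := hmono h3
  obtain ⟨l, hl⟩ := Nat.exists_eq_add_of_le hlt.le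
  have hlpos : 0 < l := by omega
  have hnj : (0 : ℝ) < nn j := by exact_mod_cast hnn j
  rw [div_le_iff₀ (by positivity)] at h2
  refine ⟨t, l, fun κ => if 0 < y.1 κ then max 0 (Γ.An (nn j) y.2 κ - η) else 0, hlpos,
    ?_, ?_, ?_, ?_⟩
  · intro κ; dsimp only; split_ifs
    · exact le_max_left _ _
    · exact le_rfl
  · intro κ; dsimp only; split_ifs
    · exact max_le zero_le_one (by linarith [Γ.An_le (nn j) y.2 κ])
    · exact zero_le_one
  · have h4 : ∑ κ, y.1 κ * (Γ.An (nn j) y.2 κ - η) = (∑ κ, y.1 κ * Γ.Sn (nn j) y.2 κ) / nn j - η := by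
      simp only [mul_sub, Finset.sum_sub_distrib, ← Finset.sum_mul, hy.2, one_mul, An,
        Finset.sum_div, mul_div_assoc]
    have h5 : c ≤ (∑ κ, y.1 κ * Γ.Sn (nn j) y.2 κ) / nn j := by
      rw [le_div_iff₀ hnj, Γ.sum_Sn]; exact hc _
    calc c - η ≤ ∑ κ, y.1 κ * (Γ.An (nn j) y.2 κ - η) := by rw [h4]; linarith
      _ ≤ _ := by
        refine Finset.sum_le_sum fun κ _ => ?_
        by_cases hκ : 0 < y.1 κ
        · dsimp only; rw [if_pos hκ]; exact mul_le_mul_of_nonneg_left (le_max_right _ _) hκ.le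
        · have : y.1 κ = 0 := le_antisymm (not_lt.1 hκ) (hy.1 κ)
          simp [this]
  · intro κ hCκ
    have hκ : 0 < y.1 κ := by
      by_contra h; simp [h] at hCκ
    refine ⟨?_, fun k hk => ?_⟩
    · rw [← hl]
      have e1 : Γ.reach y.2 κ t = R κ := congrFun hj1 κ
      have e2 : Γ.reach y.2 κ (nn j) = R κ := congrFun hjR κ
      rw [e1, e2]
    · dsimp only
      rw [if_pos hκ]
      rcases le_total (Γ.An (nn j) y.2 κ - η) 0 with h | h
      · rw [max_eq_left h, zero_mul]; exact Γ.Sn_nonneg _ _ _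
      rw [max_eq_right h]
      have h6 := h1 κ hκ k hk
      have h7 := Γ.Sn_add_le l t (fun n => y.2 (n + t)) k
      rw [add_comm l t, ← hl] at h7
      have h8 : Γ.Sn (nn j) (fun n => y.2 (n + t)) k
          = Γ.An (nn j) (fun n => y.2 (n + t)) k * nn j := by
        rw [An]; field_simp
      have h9 : (l : ℝ) ≤ nn j := by exact_mod_cast (by omega : l ≤ nn j)
      have h10 := mul_le_mul_of_nonneg_left h9 h
      have h11 := mul_le_mul_of_nonneg_right h6 hnj.le
      nlinarith

end POMDP


/-- index in the periodic play -/
def idx (t l s : ℕ) : ℕ := if s < t then s else t + (s - t) % l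

lemma idx_zero (t l : ℕ) : idx t l 0 = 0 := by
  unfold idx; split_ifs with h
  · rfl
  · have : t = 0 := by omega
    simp [this]

lemma idx_lt (t l s : ℕ) (hl : 0 < l) : idx t l s < t + l := by
  unfold idx; split_ifs with h
  · omega
  · have := Nat.mod_lt (s - t) hl; omega

lemma idx_succ (t l s : ℕ) (hl : 0 < l) :
    idx t l (s + 1) = idx t l s + 1 ∨ (idx t l s + 1 = t + l ∧ idx t l (s + 1) = t) := by
  unfold idx
  by_cases h : s < t
  · by_cases h2 : s + 1 < t
    · simp [h, h2]
    · have : s + 1 = t := by omega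
      left; simp [h, this]
  · have h2 : ¬ s + 1 < t := by omega
    simp only [h, h2, if_false]
    have e : s + 1 - t = (s - t) + 1 := by omega
    rw [e]
    have hlt := Nat.mod_lt (s - t) hl
    by_cases h3 : (s - t) % l + 1 = l
    · right
      refine ⟨by omega, ?_⟩
      have : ((s - t) + 1) % l = 0 := by
        rw [Nat.add_mod]
        rcases Nat.lt_or_ge 1 l with h4 | h4
        · rw [Nat.mod_eq_of_lt h4, h3, Nat.mod_self]
        · have : l = 1 := by omega
          subst this; omega
      omega
    · left
      have : ((s - t) + 1) % l = (s - t) % l + 1 := by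
        rw [Nat.add_mod, Nat.mod_eq_of_lt (by omega : 1 < l), Nat.mod_eq_of_lt (by omega)]
      omega

lemma idx_period (t l s : ℕ) (hs : t ≤ s) : idx t l (s + l) = idx t l s := by
  unfold idx
  rw [if_neg (by omega), if_neg (by omega)]
  have : s + l - t = (s - t) + l := by omega
  rw [this, Nat.add_mod_right]

/-- pathwise liminf bound -/
lemma liminf_lower (r : ℕ → ℝ) (h0 : ∀ n, 0 ≤ r n) (h1 : ∀ n, r n ≤ 1) (M : ℕ → ℝ)
    (hM : Tendsto (fun N : ℕ => M N / N) atTop (nhds 0)) (c B : ℝ) (m : ℕ)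
    (h : ∀ N ≥ m, c * N - B + M N ≤ ∑ n ∈ Finset.range N, r n) :
    c ≤ liminf (fun N : ℕ => (1 / N : ℝ) * ∑ n ∈ Finset.range N, r n) atTop := by
  have hlim : Tendsto (fun N : ℕ => c - B * (1 / (N : ℝ)) + M N / N) atTop (nhds c) := by
    have := ((tendsto_one_div_atTop_nhds_zero_nat (𝕜 := ℝ)).const_mul B).const_sub c |>.add hM
    simpa using this
  rw [← hlim.liminf_eq]
  refine liminf_le_liminf ?_ hlim.isBoundedUnder_ge ?_
  · filter_upwards [eventually_ge_atTop m, eventually_gt_atTop 0] with N hN hN0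
    have hN' : (0 : ℝ) < N := by exact_mod_cast hN0
    have e : c - B * (1 / (N : ℝ)) + M N / N = (1 / N : ℝ) * (c * N - B + M N) := by
      field_simp
    rw [e]
    exact mul_le_mul_of_nonneg_left (h N hN) (by positivity)
  · refine IsBoundedUnder.isCoboundedUnder_ge ?_
    refine ⟨1, ?_⟩
    rw [eventually_map]
    refine Eventually.of_forall fun N => ?_
    have hs : ∑ n ∈ Finset.range N, r n ≤ N := by
      calc _ ≤ ∑ n ∈ Finset.range N, (1 : ℝ) := Finset.sum_le_sum fun n _ => h1 n
        _ = N := by simp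
    rcases Nat.eq_zero_or_pos N with rfl | hN0
    · simp
    have hN' : (0 : ℝ) < N := by exact_mod_cast hN0
    change (1 / (N : ℝ)) * ∑ n ∈ Finset.range N, r n ≤ 1
    rw [one_div, inv_mul_le_iff₀ hN']; linarith

namespace POMDP
variable (Γ : POMDP)

/-- average reward along the process -/
noncomputable def av (as : ℕ → Γ.A) (k0 : Γ.K) (x : ℝ) (N : ℕ) : ℝ :=
  (1 / N : ℝ) * ∑ n ∈ Finset.range N, Γ.g (Γ.st as k0 x n) (as n)

/-- potential -/
def pot (τ : ℕ → Γ.A) (t l : ℕ) (c : ℝ) (i : ℕ) (k : Γ.K) : ℝ :=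
  Γ.Sn (t + l - i) (fun n => τ (n + i)) k + c * ((i : ℝ) - t)

lemma pot_step (τ : ℕ → Γ.A) (t l : ℕ) (hl : 0 < l) (c : ℝ) (κ : Γ.K)
    (hS : ∀ k ∈ Γ.reach τ κ t, c * l ≤ Γ.Sn l (fun n => τ (n + t)) k)
    (hR : Γ.reach τ κ t = Γ.reach τ κ (t + l)) (s : ℕ) (k : Γ.K)
    (hk : k ∈ Γ.reach τ κ (idx t l s)) :
    c + Γ.pot τ t l c (idx t l s) k
      ≤ Γ.g k (τ (idx t l s)) + Γ.ex (τ (idx t l s)) (Γ.pot τ t l c (idx t l (s + 1))) k := by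
  have hlt := idx_lt t l s hl
  set i := idx t l s with hi
  obtain ⟨d, hd⟩ : ∃ d, t + l - i = d + 1 := ⟨t + l - i - 1, by omega⟩
  have e1 : Γ.pot τ t l c i k = Γ.g k (τ i) + Γ.ex (τ i) (Γ.Sn d (fun n => τ (n + (i + 1)))) k
      + c * ((i : ℝ) - t) := by
    have e2 : Γ.sh (fun n => τ (n + i)) = fun n => τ (n + (i + 1)) := by
      funext n; exact congrArg τ (by omega)
    rw [pot, hd, Sn, e2]; simp
  rcases idx_succ t l s hl with h | ⟨h, h'⟩
  · rw [← hi] at h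
    rw [h, e1]
    have e3 : Γ.pot τ t l c (i + 1) = fun k' => Γ.Sn d (fun n => τ (n + (i + 1))) k'
        + c * ((i : ℝ) + 1 - t) := by
      funext k'; rw [pot]
      have : t + l - (i + 1) = d := by omega
      rw [this]; push_cast; ring
    rw [e3, Γ.ex_add_const]
    linarith
  · rw [← hi] at h
    rw [h', e1]
    have hd0 : d = 0 := by omega
    subst hd0
    have e4 : Γ.ex (τ i) (Γ.Sn 0 (fun n => τ (n + (i + 1)))) k = 0 := Γ.ex_const (τ i) 0 k
    rw [e4]
    have e5 : Γ.ex (τ i) (fun _ => c * l) k ≤ Γ.ex (τ i) (Γ.pot τ t l c t) k := by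
      refine Finset.sum_le_sum fun k' _ => ?_
      rcases (Γ.tr_nonneg (τ i) k k').eq_or_lt with h0 | h0
      · rw [← h0]; simp
      · refine mul_le_mul_of_nonneg_left ?_ h0.le
        have hk' : k' ∈ Γ.reach τ κ t := by
          rw [hR, ← h]; exact ⟨k, hk, h0⟩
        have := hS k' hk'
        rw [pot]; simpa using this
    rw [Γ.ex_const] at e5
    have : (i : ℝ) + 1 = t + l := by exact_mod_cast h
    have e6 : c * (i : ℝ) + c = c * t + c * l := by rw [← mul_add, ← this]; ring
    nlinarith

lemma pot_bdd (τ : ℕ → Γ.A) (t l : ℕ) (c : ℝ) (hc : 0 ≤ c) (i : ℕ) (hi : i ≤ t + l) (k : Γ.K) :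
    |Γ.pot τ t l c i k| ≤ (t + l) + c * (t + l) := by
  have h1 := Γ.Sn_nonneg (t + l - i) (fun n => τ (n + i)) k
  have h2 := Γ.Sn_le (t + l - i) (fun n => τ (n + i)) k
  have h3 : ((t + l - i : ℕ) : ℝ) ≤ t + l := by exact_mod_cast Nat.sub_le _ _
  have h4 : (i : ℝ) ≤ t + l := by exact_mod_cast hi
  have h5 : (0 : ℝ) ≤ t := Nat.cast_nonneg _
  have h6 : (0 : ℝ) ≤ l := Nat.cast_nonneg _
  have h7 : (0 : ℝ) ≤ i := Nat.cast_nonneg _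
  have h8 : c * ((i : ℝ) - t) ≤ c * (t + l) := mul_le_mul_of_nonneg_left (by linarith) hc
  have h9 : c * (-(t + l)) ≤ c * ((i : ℝ) - t) := mul_le_mul_of_nonneg_left (by linarith) hc
  rw [pot, abs_le]
  constructor <;> linarith

lemma path_liminf (τ : ℕ → Γ.A) (t l : ℕ) (hl : 0 < l) (C : Γ.K → ℝ) (hC : ∀ κ, 0 ≤ C κ)
    (hp : ∀ κ, C κ ≠ 0 → Γ.reach τ κ t = Γ.reach τ κ (t + l) ∧
        ∀ k ∈ Γ.reach τ κ t, C κ * l ≤ Γ.Sn l (fun n => τ (n + t)) k)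
    (ρ : ℕ → Γ.A) (m : ℕ) (hρ : ∀ n, ρ (m + n) = τ (idx t l n)) (k0 : Γ.K) :
    ∀ᵐ x ∂lam, C (Γ.st ρ k0 x m) ≤ liminf (Γ.av ρ k0 x) atTop := by
  let f : Γ.K → ℕ → Γ.K → ℝ := fun κ n => Γ.pot τ t l (C κ) (idx t l (n + 1 - m))
  have hf : ∀ κ n k, |f κ n k| ≤ (t + l) + C κ * (t + l) := fun κ n k =>
    Γ.pot_bdd τ t l (C κ) (hC κ) _ (idx_lt _ _ _ hl).le k
  have hall : ∀ᵐ x ∂lam, ∀ κ, Tendsto (fun N : ℕ => Γ.mg ρ (f κ) k0 N x / N) atTop (nhds 0) :=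
    ae_all_iff.2 fun κ => Γ.mg_slln ρ (f κ) (hf κ) k0
  filter_upwards [hall, Γ.st_pos ρ k0] with x hx hpos
  set κ := Γ.st ρ k0 x m with hκ
  have hg0 : ∀ n, 0 ≤ Γ.g (Γ.st ρ k0 x n) (ρ n) := fun n => Γ.g_nonneg _ _
  have hg1 : ∀ n, Γ.g (Γ.st ρ k0 x n) (ρ n) ≤ 1 := fun n => Γ.g_le_one _ _
  by_cases h0 : C κ = 0
  · rw [h0]
    refine liminf_lower _ hg0 hg1 (fun _ => 0) (by simp) 0 0 0 fun N _ => ?_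
    simpa using Finset.sum_nonneg fun n _ => hg0 n
  obtain ⟨hR, hS⟩ := hp κ h0
  have hreach : ∀ n, Γ.st ρ k0 x (m + n) ∈ Γ.reach τ κ (idx t l n) := by
    intro n
    induction n with
    | zero => rw [idx_zero]; exact hκ.symm
    | succ n ih =>
      have h1 : Γ.st ρ k0 x (m + (n + 1)) ∈ Γ.reach τ κ (idx t l n + 1) := by
        refine ⟨_, ih, ?_⟩
        rw [← hρ]; exact hpos (m + n)
      rcases idx_succ t l n hl with h | ⟨h, h'⟩
      · rw [h]; exact h1
      · rw [h', hR, ← h]; exact h1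
  set B : ℝ := (t + l) + C κ * (t + l) with hB
  have key : ∀ n, C κ * n + Γ.pot τ t l (C κ) (idx t l 0) (Γ.st ρ k0 x m)
      - Γ.pot τ t l (C κ) (idx t l n) (Γ.st ρ k0 x (m + n))
      + (Γ.mg ρ (f κ) k0 (m + n) x - Γ.mg ρ (f κ) k0 m x)
      ≤ ∑ i ∈ Finset.range (m + n), Γ.g (Γ.st ρ k0 x i) (ρ i) := by
    intro n
    induction n with
    | zero => simpa using Finset.sum_nonneg fun n _ => hg0 n
    | succ n ih =>
      have h1 := Γ.pot_step τ t l hl (C κ) κ hS hR n _ (hreach n)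
      have e1 : Γ.mg ρ (f κ) k0 (m + (n + 1)) x = Γ.mg ρ (f κ) k0 (m + n) x
          + (f κ (m + n) (Γ.st ρ k0 x (m + n + 1))
            - Γ.ex (ρ (m + n)) (f κ (m + n)) (Γ.st ρ k0 x (m + n))) := Finset.sum_range_succ _ _
      have e2 : f κ (m + n) = Γ.pot τ t l (C κ) (idx t l (n + 1)) := by
        simp only [f]; congr 2; omega
      rw [e1, e2, ← add_assoc m n 1, Finset.sum_range_succ]
      rw [← hρ] at h1
      rw [← add_assoc m n 1] at *
      push_cast
      linarith
  refine liminf_lower _ hg0 hg1 _ (hx κ) (C κ) (C κ * m + 2 * B + Γ.mg ρ (f κ) k0 m x) m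
    fun N hN => ?_
  obtain ⟨n, rfl⟩ := Nat.exists_eq_add_of_le hN
  have h1 := key n
  have h2 := abs_le.1 (Γ.pot_bdd τ t l (C κ) (hC κ) _ (idx_lt t l 0 hl).le (Γ.st ρ k0 x m))
  have h3 := abs_le.1 (Γ.pot_bdd τ t l (C κ) (hC κ) _ (idx_lt t l n hl).le (Γ.st ρ k0 x (m + n)))
  rw [← hB] at h2 h3
  push_cast
  linarith [h2.1, h3.2]

end POMDP

namespace POMDP
variable (Γ : POMDP)

lemma av_nonneg (as : ℕ → Γ.A) (k0 : Γ.K) (x : ℝ) (N : ℕ) : 0 ≤ Γ.av as k0 x N :=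
  mul_nonneg (by positivity) (Finset.sum_nonneg fun _ _ => Γ.g_nonneg _ _)

lemma av_le (as : ℕ → Γ.A) (k0 : Γ.K) (x : ℝ) (N : ℕ) : Γ.av as k0 x N ≤ 1 := by
  have hs : ∑ n ∈ Finset.range N, Γ.g (Γ.st as k0 x n) (as n) ≤ N := by
    calc _ ≤ ∑ n ∈ Finset.range N, (1 : ℝ) := Finset.sum_le_sum fun n _ => Γ.g_le_one _ _
      _ = N := by simp
  rw [av]
  rcases Nat.eq_zero_or_pos N with rfl | hN0
  · simp
  have hN' : (0 : ℝ) < N := by exact_mod_cast hN0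
  rw [one_div, inv_mul_le_iff₀ hN']; linarith

lemma av_meas (as : ℕ → Γ.A) (k0 : Γ.K) (N : ℕ) : Measurable (fun x => Γ.av as k0 x N) := by
  refine Measurable.const_mul (Finset.measurable_fun_sum _ fun n _ => ?_) _
  exact Γ.comp_meas as k0 (fun k => Γ.g k (as n)) n

lemma av_bdd_ge (as : ℕ → Γ.A) (k0 : Γ.K) (x : ℝ) :
    IsBoundedUnder (· ≥ ·) atTop (Γ.av as k0 x) :=
  isBoundedUnder_of ⟨0, fun N => Γ.av_nonneg as k0 x N⟩

lemma av_bdd_le (as : ℕ → Γ.A) (k0 : Γ.K) (x : ℝ) :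
    IsBoundedUnder (· ≤ ·) atTop (Γ.av as k0 x) :=
  isBoundedUnder_of ⟨1, fun N => Γ.av_le as k0 x N⟩

/-- pathwise payoff -/
noncomputable def li (as : ℕ → Γ.A) (k0 : Γ.K) (x : ℝ) : ℝ := liminf (Γ.av as k0 x) atTop

lemma li_nonneg (as : ℕ → Γ.A) (k0 : Γ.K) (x : ℝ) : 0 ≤ Γ.li as k0 x :=
  le_liminf_of_le (Γ.av_bdd_le as k0 x).isCoboundedUnder_ge
    (Eventually.of_forall fun N => Γ.av_nonneg as k0 x N)

lemma li_le (as : ℕ → Γ.A) (k0 : Γ.K) (x : ℝ) : Γ.li as k0 x ≤ 1 :=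
  liminf_le_of_le (Γ.av_bdd_ge as k0 x) fun b hb => by
    obtain ⟨N, hN⟩ := hb.exists
    exact hN.trans (Γ.av_le as k0 x N)

lemma li_meas (as : ℕ → Γ.A) (k0 : Γ.K) : Measurable (Γ.li as k0) :=
  Measurable.liminf fun N => Γ.av_meas as k0 N

lemma li_int (as : ℕ → Γ.A) (k0 : Γ.K) : Integrable (Γ.li as k0) lam :=
  integrable_of_bdd (Γ.li_meas as k0) (C := 1) fun x => by
    rw [abs_of_nonneg (Γ.li_nonneg _ _ _)]; exact Γ.li_le _ _ _

lemma traj_blind (as : ℕ → Γ.A) (ω : Γ.Env) (m : ℕ) :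
    (Γ.traj (Γ.blindStrat as) ω m).1 = Γ.st as ω.1 ω.2 m ∧
      (Γ.traj (Γ.blindStrat as) ω m).2.length = m := by
  induction m with
  | zero => exact ⟨rfl, rfl⟩
  | succ m ih =>
    obtain ⟨h1, h2⟩ := ih
    simp only [traj, st, List.length_append, List.length_singleton, h2, and_true, h1,
      blindStrat]

lemma avg_blind (as : ℕ → Γ.A) (ω : Γ.Env) :
    Γ.avg (Γ.blindStrat as) ω = Γ.av as ω.1 ω.2 := by
  funext N
  rw [avg, av]
  congr 1
  refine Finset.sum_congr rfl fun n _ => ?_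
  obtain ⟨h1, h2⟩ := Γ.traj_blind as ω n
  simp only [rew, state, act, hist, h1, blindStrat, h2]

lemma pay_blind (p : Γ.K → ℝ) (hp : IsBelief p) (as : ℕ → Γ.A) :
    Γ.pay p (Γ.blindStrat as) = ∑ k, p k * ∫ x, Γ.li as k x ∂lam := by
  have e : ∀ ω, atTop.liminf (Γ.avg (Γ.blindStrat as) ω) = Γ.li as ω.1 ω.2 := fun ω => by
    rw [avg_blind, li]
  simp only [pay, e]
  have hfin : IsFiniteMeasure (vecMeasure p) := by
    refine ⟨?_⟩
    simp [vecMeasure, ENNReal.sum_lt_top]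
  have hlam : Γ.envMeasure p = (vecMeasure p).prod lam := rfl
  have hm : Measurable (fun ω : Γ.Env => Γ.li as ω.1 ω.2) :=
    measurable_from_prod_countable_right fun k => Γ.li_meas as k
  have hint : Integrable (fun ω : Γ.Env => Γ.li as ω.1 ω.2) ((vecMeasure p).prod lam) :=
    Integrable.of_bound hm.aestronglyMeasurable 1 (ae_of_all _ fun ω => by
      rw [Real.norm_eq_abs, abs_of_nonneg (Γ.li_nonneg _ _ _)]; exact Γ.li_le _ _ _)
  rw [hlam, integral_prod _ hint, vecMeasure, integral_finsetSum_measure]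
  · refine Finset.sum_congr rfl fun k _ => ?_
    rw [integral_smul_measure, integral_dirac, ENNReal.toReal_ofReal (hp.1 k), smul_eq_mul]
  · intro k _
    exact (Integrable.of_finite).smul_measure ENNReal.ofReal_ne_top

lemma blind_seq (hΓ : Γ.Blind) (σ : Γ.Strategy) :
    ∃ as : ℕ → Γ.A, ∀ ω, Γ.avg σ ω = Γ.avg (Γ.blindStrat as) ω := by
  let s0 : Γ.S := ⟨0, Γ.hS⟩
  have hs : ∀ s : Γ.S, s = s0 := fun s => by
    have := s.2; have h1 : Γ.nS = 1 := hΓ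
    exact Fin.ext (by simp only [s0]; omega)
  let H : ℕ → Γ.Hist := fun m => Nat.rec [] (fun _ h => h ++ [(σ h, s0)]) m
  have hH : ∀ m, H (m + 1) = H m ++ [(σ (H m), s0)] := fun m => rfl
  let as : ℕ → Γ.A := fun m => σ (H m)
  have ht : ∀ ω m, Γ.traj σ ω m = (Γ.st as ω.1 ω.2 m, H m) := by
    intro ω m
    induction m with
    | zero => rfl
    | succ m ih =>
      simp only [traj, st, ih, hH, as]
      rw [hs (sampleOn (Γ.q (Γ.st (fun m => σ (H m)) ω.1 ω.2 m) (σ (H m))) (unif ω.2 m)).2]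
  refine ⟨as, fun ω => ?_⟩
  rw [avg_blind]
  funext N
  rw [avg, av]
  congr 1
  refine Finset.sum_congr rfl fun n _ => ?_
  simp only [rew, state, act, hist, ht, as]

lemma law (p : Γ.K → ℝ) (as : ℕ → Γ.A) (m : ℕ) (f : Γ.K → ℝ) :
    ∑ k, p k * ∫ x, f (Γ.st as k x m) ∂lam = ∑ k, (Γ.F^[m] (p, as)).1 k * f k := by
  induction m generalizing f with
  | zero => simp [st]
  | succ m ih =>
    have h : ∀ k, ∫ x, f (Γ.st as k x (m + 1)) ∂lam
        = ∫ x, Γ.ex (as m) f (Γ.st as k x m) ∂lam := fun k => by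
      have := Γ.cond_step as k m (fun _ => 1) measurable_const ⟨1, fun _ => by simp⟩ f
      simpa using this
    simp only [h]
    rw [ih, Function.iterate_succ_apply', Γ.sum_F, Fi_act]

lemma av_law (p : Γ.K → ℝ) (as : ℕ → Γ.A) (N : ℕ) :
    ∑ k, p k * ∫ x, Γ.av as k x N ∂lam
      = (1 / N : ℝ) * ∑ n ∈ Finset.range N, Γ.u (Γ.F^[n] (p, as)) := by
  have h1 : ∀ k, ∫ x, Γ.av as k x N ∂lam
      = (1 / N : ℝ) * ∑ n ∈ Finset.range N, ∫ x, Γ.g (Γ.st as k x n) (as n) ∂lam := by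
    intro k
    simp only [av]
    rw [integral_const_mul, integral_finsetSum]
    intro n _
    exact integrable_of_bdd (Γ.comp_meas as k (fun k => Γ.g k (as n)) n) (C := 1) fun x => by
      rw [abs_of_nonneg (Γ.g_nonneg _ _)]; exact Γ.g_le_one _ _
  simp only [h1, Finset.mul_sum]
  rw [Finset.sum_comm]
  refine Finset.sum_congr rfl fun n _ => ?_
  have := Γ.law p as n (fun k => Γ.g k (as n))
  rw [u, Fi_act, ← this, Finset.mul_sum]
  exact Finset.sum_congr rfl fun k _ => by ring

lemma upper (p : Γ.K → ℝ) (hp : IsBelief p) (as : ℕ → Γ.A) (δ : ℝ) (hδ : 0 < δ) :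
    ∀ᶠ N : ℕ in atTop, (∑ k, p k * ∫ x, Γ.li as k x ∂lam - δ) * N
      ≤ ∑ n ∈ Finset.range N, Γ.u (Γ.F^[n] (p, as)) := by
  have hpt : ∀ k x, Tendsto (fun N => min (Γ.av as k x N) (Γ.li as k x)) atTop
      (nhds (Γ.li as k x)) := by
    intro k x
    refine tendsto_order.2 ⟨fun b hb => ?_, fun b hb => ?_⟩
    · filter_upwards [eventually_lt_of_lt_liminf hb (Γ.av_bdd_ge as k x)] with N hN
      exact lt_min hN hb
    · exact Eventually.of_forall fun N => (min_le_right _ _).trans_lt hb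
  have hmm : ∀ k N, Measurable (fun x => min (Γ.av as k x N) (Γ.li as k x)) := fun k N =>
    (Γ.av_meas as k N).min (Γ.li_meas as k)
  have hmb : ∀ k N x, |min (Γ.av as k x N) (Γ.li as k x)| ≤ 1 := fun k N x => by
    rw [abs_of_nonneg (le_min (Γ.av_nonneg _ _ _ _) (Γ.li_nonneg _ _ _))]
    exact (min_le_left _ _).trans (Γ.av_le _ _ _ _)
  have hint : ∀ k, Tendsto (fun N => ∫ x, min (Γ.av as k x N) (Γ.li as k x) ∂lam) atTop
      (nhds (∫ x, Γ.li as k x ∂lam)) := fun k =>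
    tendsto_integral_of_dominated_convergence (fun _ => 1)
      (fun N => (hmm k N).aestronglyMeasurable) (integrable_const _)
      (fun N => ae_of_all _ (hmb k N)) (ae_of_all _ (hpt k))
  have hsum : Tendsto (fun N => ∑ k, p k * ∫ x, min (Γ.av as k x N) (Γ.li as k x) ∂lam) atTop
      (nhds (∑ k, p k * ∫ x, Γ.li as k x ∂lam)) :=
    tendsto_finsetSum _ fun k _ => (hint k).const_mul _
  filter_upwards [hsum.eventually (lt_mem_nhds (sub_lt_self _ hδ)), eventually_gt_atTop 0]
    with N hN hN0
  have hN' : (0 : ℝ) < N := by exact_mod_cast hN0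
  have h1 : ∑ k, p k * ∫ x, min (Γ.av as k x N) (Γ.li as k x) ∂lam
      ≤ ∑ k, p k * ∫ x, Γ.av as k x N ∂lam := by
    refine Finset.sum_le_sum fun k _ => mul_le_mul_of_nonneg_left ?_ (hp.1 k)
    refine integral_mono (integrable_of_bdd (hmm k N) (hmb k N))
      (integrable_of_bdd (Γ.av_meas as k N) (C := 1) fun x => ?_) fun x => min_le_left _ _
    rw [abs_of_nonneg (Γ.av_nonneg _ _ _ _)]; exact Γ.av_le _ _ _ _
  rw [av_law] at h1
  have h2 := hN.le.trans h1
  rw [one_div, ← div_eq_inv_mul, le_div_iff₀ hN'] at h2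
  exact h2

lemma Fi_congr (p : Γ.K → ℝ) (as bs : ℕ → Γ.A) (m : ℕ) (h : ∀ n < m, as n = bs n) :
    (Γ.F^[m] (p, as)).1 = (Γ.F^[m] (p, bs)).1 := by
  induction m with
  | zero => rfl
  | succ m ih =>
    rw [Function.iterate_succ_apply', Function.iterate_succ_apply']
    funext k'
    change ∑ k, (Γ.F^[m] (p, as)).1 k * Γ.tr ((Γ.F^[m] (p, as)).2 0) k k'
      = ∑ k, (Γ.F^[m] (p, bs)).1 k * Γ.tr ((Γ.F^[m] (p, bs)).2 0) k k'
    rw [Fi_act, Fi_act, ih fun n hn => h n (by omega)]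
    simp only [h m (by omega)]

end POMDP

theorem eventuallyPeriodic_eps_optimal (Γ : POMDP) (hΓ : Γ.Blind)
    (p1 : Γ.K → ℝ) (hp1 : IsBelief p1) (ε : ℝ) (hε : 0 < ε) :
    ∃ as : ℕ → Γ.A, EventuallyPeriodic as ∧
      Γ.pay p1 (Γ.blindStrat as) ≥ Γ.val p1 - ε := by
  obtain ⟨σ, hσ⟩ := exists_lt_of_lt_ciSup
    (show Γ.val p1 - ε / 2 < ⨆ σ : Γ.Strategy, Γ.pay p1 σ from by
      change Γ.val p1 - ε / 2 < Γ.val p1; linarith)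
  obtain ⟨as, has⟩ := Γ.blind_seq hΓ σ
  have hpay : Γ.pay p1 σ = ∑ k, p1 k * ∫ x, Γ.li as k x ∂lam := by
    rw [← Γ.pay_blind p1 hp1 as]; simp only [POMDP.pay, has]
  set V := ∑ k, p1 k * ∫ x, Γ.li as k x ∂lam with hV
  rw [hpay] at hσ
  rcases le_or_gt V (ε / 2) with hsmall | hbig
  · refine ⟨fun _ => ⟨0, Γ.hA⟩, ⟨1, le_rfl, 1, le_rfl, fun _ _ => rfl⟩, ?_⟩
    rw [Γ.pay_blind p1 hp1]
    have : 0 ≤ ∑ k, p1 k * ∫ x, Γ.li (fun _ => ⟨0, Γ.hA⟩) k x ∂lam :=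
      Finset.sum_nonneg fun k _ => mul_nonneg (hp1.1 k) (integral_nonneg fun x => Γ.li_nonneg _ _ _)
    linarith
  · have hup : ∀ M0 : ℕ, ∃ M ≥ M0, ((V - ε / 4) + ε / 8) * M
        ≤ ∑ m ∈ Finset.range M, Γ.u (Γ.F^[m] (p1, as)) := by
      intro M0
      obtain ⟨M, h1, h2⟩ :=
        ((Γ.upper p1 hp1 as (ε / 8) (by positivity)).and (eventually_ge_atTop M0)).exists
      refine ⟨M, h2, le_trans (le_of_eq ?_) h1⟩
      rw [← hV]; ring
    obtain ⟨nn, hnn, hmono, y, hy, hyc, hyD, hyx⟩ := Γ.limit_point (x0 := (p1, as)) hp1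
      (V - ε / 4) (ε / 8) (by linarith) (by positivity) hup
    obtain ⟨t, l, C, hl, hC0, hC1, hCs, hCp⟩ := Γ.choose_period hy (V - ε / 4) nn hnn hmono hyc hyD
      (ε / 16) (by positivity)
    obtain ⟨m, hm⟩ := hyx (ε / 16) (by positivity)
    let ρ : ℕ → Γ.A := fun n => if n < m then as n else y.2 (idx t l (n - m))
    have hρ : ∀ n, ρ (m + n) = y.2 (idx t l n) := fun n => by simp [ρ]
    refine ⟨ρ, ⟨l, hl, m + t + 1, by omega, fun n hn => ?_⟩, ?_⟩
    · obtain ⟨d, rfl⟩ := Nat.exists_eq_add_of_le (show m ≤ n by omega)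
      rw [add_assoc, hρ, hρ, idx_period _ _ _ (by omega)]
    · rw [Γ.pay_blind p1 hp1]
      have h1 : ∑ k, p1 k * ∫ x, C (Γ.st ρ k x m) ∂lam ≤ ∑ k, p1 k * ∫ x, Γ.li ρ k x ∂lam := by
        refine Finset.sum_le_sum fun k _ => mul_le_mul_of_nonneg_left ?_ (hp1.1 k)
        refine integral_mono_ae (integrable_of_bdd (Γ.comp_meas ρ k C m) (C := 1) fun x => ?_)
          (Γ.li_int ρ k) (Γ.path_liminf y.2 t l hl C hC0 hCp ρ m hρ k)
        rw [abs_of_nonneg (hC0 _)]; exact hC1 _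
      rw [Γ.law, Γ.Fi_congr p1 ρ as m fun n hn => by simp [ρ, hn]] at h1
      have h2 : ∑ κ, y.1 κ * C κ - ∑ κ, (Γ.F^[m] (p1, as)).1 κ * C κ
          ≤ ∑ k, |(Γ.F^[m] (p1, as)).1 k - y.1 k| := by
        rw [← Finset.sum_sub_distrib]
        refine Finset.sum_le_sum fun κ _ => ?_
        rw [← sub_mul, abs_sub_comm]
        calc (y.1 κ - (Γ.F^[m] (p1, as)).1 κ) * C κ
            ≤ |y.1 κ - (Γ.F^[m] (p1, as)).1 κ| * C κ :=
              mul_le_mul_of_nonneg_right (le_abs_self _) (hC0 κ)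
          _ ≤ _ := mul_le_of_le_one_right (abs_nonneg _) (hC1 κ)
      linarith

end PomdpPaper
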